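/- arXiv:2105.05315 — 2 statements merged into one kernel-verified Lean document; each statement's English description precedes it below -/
import Mathlib

section
/- If two nonempty relations R and S over the same model 𝔐 are both defined by the same first-order formula θ(x̄, ȳ) over the empty signature, and θ fixes the identity type of ȳ, then there is a bijection h : M → M (where M is the domain of 𝔐) that maps R onto S, i.e., h[R] = S where h is applied componentwise to tuples. -/
namespace DSFO

/-- A purely relational signature: for each arity, a type of relation symbols. -/
abbrev Signature := ℕ → Type

/-- The empty signature. -/
def Sig0 : Signature := fun _ => Empty

/-- The signature with a single `k`-ary relation symbol `R`. -/
def SigR (k : ℕ) : Signature := fun n => PLift (n = k)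

/-- Syntax of team-semantics formulas (in negation normal form, with the two
additional connectives: global disjunction `gdisj` and contradictory negation
`cneg`) over a relational signature `S`, with generalized dependency atoms
indexed by `ι` with arities `ar`.  Variables are natural numbers. -/
inductive TS (S : Signature) (ι : Type) (ar : ι → ℕ) : Type
  | rel {k : ℕ} (r : S k) (v : Fin k → ℕ)
  | nrel {k : ℕ} (r : S k) (v : Fin k → ℕ)
  | eq (x y : ℕ)
  | neq (x y : ℕ)
  | dep (i : ι) (v : Fin (ar i) → ℕ)
  | and (φ ψ : TS S ι ar)
  | or (φ ψ : TS S ι ar)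
  | gdisj (φ ψ : TS S ι ar)
  | cneg (φ : TS S ι ar)
  | ex (v : ℕ) (φ : TS S ι ar)
  | al (v : ℕ) (φ : TS S ι ar)

/-- The always-true literal `⊤`. -/
def TS.top {S : Signature} {ι : Type} {ar : ι → ℕ} : TS S ι ar := .eq 0 0

/-- The arity function for "no dependency atoms". -/
def noAtoms : Empty → ℕ := fun e => e.elim

/-- First-order formulas over `S` (no dependency atoms; here `cneg` plays the
role of ordinary classical negation and `gdisj` of ordinary disjunction, so
this is full first-order logic). -/
abbrev FOF (S : Signature) := TS S Empty noAtoms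

/-- First-order formulas over the empty signature. -/
abbrev EF := FOF Sig0

/-- Free variables of a formula. -/
def fv {S : Signature} {ι : Type} {ar : ι → ℕ} : TS S ι ar → Set ℕ
  | .rel _ v => Set.range v
  | .nrel _ v => Set.range v
  | .eq x y => {x, y}
  | .neq x y => {x, y}
  | .dep _ v => Set.range v
  | .and φ ψ => fv φ ∪ fv ψ
  | .or φ ψ => fv φ ∪ fv ψ
  | .gdisj φ ψ => fv φ ∪ fv ψ
  | .cneg φ => fv φ
  | .ex v φ => fv φ \ {v}
  | .al v φ => fv φ \ {v}

/-- A sentence is a formula with no free variables. -/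
def IsSentence {S : Signature} {ι : Type} {ar : ι → ℕ} (φ : TS S ι ar) : Prop :=
  fv φ = ∅

/-- No global disjunctions occur. -/
def NoGdisj {S : Signature} {ι : Type} {ar : ι → ℕ} : TS S ι ar → Prop
  | .rel _ _ => True
  | .nrel _ _ => True
  | .eq _ _ => True
  | .neq _ _ => True
  | .dep _ _ => True
  | .and φ ψ => NoGdisj φ ∧ NoGdisj ψ
  | .or φ ψ => NoGdisj φ ∧ NoGdisj ψ
  | .gdisj _ _ => False
  | .cneg φ => NoGdisj φ
  | .ex _ φ => NoGdisj φ
  | .al _ φ => NoGdisj φ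

/-- No contradictory negations occur. -/
def NoCneg {S : Signature} {ι : Type} {ar : ι → ℕ} : TS S ι ar → Prop
  | .rel _ _ => True
  | .nrel _ _ => True
  | .eq _ _ => True
  | .neq _ _ => True
  | .dep _ _ => True
  | .and φ ψ => NoCneg φ ∧ NoCneg ψ
  | .or φ ψ => NoCneg φ ∧ NoCneg ψ
  | .gdisj φ ψ => NoCneg φ ∧ NoCneg ψ
  | .cneg _ => False
  | .ex _ φ => NoCneg φ
  | .al _ φ => NoCneg φ

/-- Formulas of `FO(𝒟)` proper: no `gdisj` and no `cneg`. -/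
def Plain {S : Signature} {ι : Type} {ar : ι → ℕ} (φ : TS S ι ar) : Prop :=
  NoCneg φ ∧ NoGdisj φ

/-- Atomic formulas: first-order literals and dependency atoms. -/
def Atomic {S : Signature} {ι : Type} {ar : ι → ℕ} : TS S ι ar → Prop
  | .rel _ _ => True
  | .nrel _ _ => True
  | .eq _ _ => True
  | .neq _ _ => True
  | .dep _ _ => True
  | _ => False

/-- Formulas of `FO(∼₀, 𝒟)`: the contradictory negation may appear only in
front of first-order literals and dependency atoms (and there is no `gdisj`). -/
def Cneg0 {S : Signature} {ι : Type} {ar : ι → ℕ} : TS S ι ar → Prop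
  | .rel _ _ => True
  | .nrel _ _ => True
  | .eq _ _ => True
  | .neq _ _ => True
  | .dep _ _ => True
  | .and φ ψ => Cneg0 φ ∧ Cneg0 ψ
  | .or φ ψ => Cneg0 φ ∧ Cneg0 ψ
  | .gdisj _ _ => False
  | .cneg φ => Atomic φ
  | .ex _ φ => Cneg0 φ
  | .al _ φ => Cneg0 φ

/-- The negation normal form of the (dual) negation of a formula. -/
def TS.nneg {S : Signature} {ι : Type} {ar : ι → ℕ} : TS S ι ar → TS S ι ar
  | .rel r v => .nrel r v
  | .nrel r v => .rel r v
  | .eq x y => .neq x y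
  | .neq x y => .eq x y
  | .dep i v => .cneg (.dep i v)
  | .and φ ψ => .or (TS.nneg φ) (TS.nneg ψ)
  | .or φ ψ => .and (TS.nneg φ) (TS.nneg ψ)
  | .gdisj φ ψ => .and (TS.nneg φ) (TS.nneg ψ)
  | .cneg φ => φ
  | .ex v φ => .al v (TS.nneg φ)
  | .al v φ => .ex v (TS.nneg φ)

/-- Iterated existential quantification over a list of variables. -/
def exs {S : Signature} {ι : Type} {ar : ι → ℕ} (l : List ℕ) (φ : TS S ι ar) :
    TS S ι ar := l.foldr TS.ex φ

/-- An interpretation of a relational signature in a domain `M`. -/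
abbrev Interp (S : Signature) (M : Type) := ∀ k, S k → Set (Fin k → M)

/-- The unique interpretation of the empty signature. -/
def eI (M : Type) : Interp Sig0 M := fun _ e => e.elim

/-- The interpretation of `SigR k` given by a `k`-ary relation `R`. -/
def interpR {k : ℕ} {M : Type} (R : Set (Fin k → M)) : Interp (SigR k) M :=
  fun _ r => {s | (fun i => s (Fin.cast r.down.symm i)) ∈ R}

/-- Tarskian (single-assignment) satisfaction.  Dependency atoms are
(vacuously) interpreted as true; this is only used on first-order formulas. -/
def FSat {S : Signature} {ι : Type} {ar : ι → ℕ} (M : Type) (I : Interp S M) :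
    (ℕ → M) → TS S ι ar → Prop
  | s, .rel r v => (fun i => s (v i)) ∈ I _ r
  | s, .nrel r v => (fun i => s (v i)) ∉ I _ r
  | s, .eq x y => s x = s y
  | s, .neq x y => s x ≠ s y
  | _, .dep _ _ => True
  | s, .and φ ψ => FSat M I s φ ∧ FSat M I s ψ
  | s, .or φ ψ => FSat M I s φ ∨ FSat M I s ψ
  | s, .gdisj φ ψ => FSat M I s φ ∨ FSat M I s ψ
  | s, .cneg φ => ¬ FSat M I s φ
  | s, .ex v φ => ∃ m : M, FSat M I (Function.update s v m) φ
  | s, .al v φ => ∀ m : M, FSat M I (Function.update s v m) φ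

/-- Truth of a first-order sentence (Tarskian semantics). -/
def FOTrue {S : Signature} {ι : Type} {ar : ι → ℕ} (M : Type) (I : Interp S M)
    (φ : TS S ι ar) : Prop :=
  ∀ s : ℕ → M, FSat M I s φ

/-- The relation `X(x̄)` determined by a team `X` and a tuple of variables `x̄`. -/
def teamProj {M : Type} {k : ℕ} (v : Fin k → ℕ) (X : Set (ℕ → M)) :
    Set (Fin k → M) := {t | ∃ s ∈ X, t = fun j => s (v j)}

/-- (Lax) team semantics.  `A` gives the semantics of each dependency atom as a
function of the relation `X(x̄)`. -/
def TSat {S : Signature} {ι : Type} {ar : ι → ℕ} (M : Type) (I : Interp S M)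
    (A : ∀ i, Set (Fin (ar i) → M) → Prop) :
    TS S ι ar → Set (ℕ → M) → Prop
  | .rel r v, X => ∀ s ∈ X, (fun i => s (v i)) ∈ I _ r
  | .nrel r v, X => ∀ s ∈ X, (fun i => s (v i)) ∉ I _ r
  | .eq x y, X => ∀ s ∈ X, s x = s y
  | .neq x y, X => ∀ s ∈ X, s x ≠ s y
  | .dep i v, X => A i (teamProj v X)
  | .and φ ψ, X => TSat M I A φ X ∧ TSat M I A ψ X
  | .or φ ψ, X => ∃ Y Z : Set (ℕ → M), Y ∪ Z = X ∧ TSat M I A φ Y ∧ TSat M I A ψ Z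
  | .gdisj φ ψ, X => TSat M I A φ X ∨ TSat M I A ψ X
  | .cneg φ, X => ¬ TSat M I A φ X
  | .ex v φ, X => ∃ H : (ℕ → M) → Set M, (∀ s ∈ X, (H s).Nonempty) ∧
      TSat M I A φ {s' | ∃ s ∈ X, ∃ m ∈ H s, s' = Function.update s v m}
  | .al v φ, X => TSat M I A φ {s' | ∃ s ∈ X, ∃ m : M, s' = Function.update s v m}

/-- Truth of a sentence under team semantics: satisfaction by the team of all
assignments (by locality, equivalent to satisfaction by `{∅}`). -/
def TTrue {S : Signature} {ι : Type} {ar : ι → ℕ} (M : Type) (I : Interp S M)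
    (A : ∀ i, Set (Fin (ar i) → M) → Prop) (φ : TS S ι ar) : Prop :=
  TSat M I A φ Set.univ

/-- A `k`-ary dependency predicate: a class of pairs `(M, R)`. -/
abbrev DepPred (k : ℕ) := ∀ M : Type, Set (Fin k → M) → Prop

/-- Closure under isomorphisms (part of the definition of a generalized
dependency). -/
def IsoClosed {k : ℕ} (D : DepPred k) : Prop :=
  ∀ (M N : Type) (e : M ≃ N) (R : Set (Fin k → M)),
    D M R → D N ((fun f => e ∘ f) '' R)

/-- The complement `∼D` of a dependency. -/
def complD {k : ℕ} (D : DepPred k) : DepPred k := fun M R => ¬ D M R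

def DownwardsClosed {k : ℕ} (D : DepPred k) : Prop :=
  ∀ (M : Type) (R R' : Set (Fin k → M)), D M R → R' ⊆ R → D M R'

/-- The downwards closure `D↓`. -/
def dClosure {k : ℕ} (D : DepPred k) : DepPred k :=
  fun M R => ∃ R', R ⊆ R' ∧ D M R'

/-- `D_max`: the maximal models of `D`. -/
def DMax {k : ℕ} (D : DepPred k) : DepPred k :=
  fun M R => D M R ∧ ∀ R', R ⊂ R' → ¬ D M R'

/-- The empty team property. -/
def EmptyTeamProp {k : ℕ} (D : DepPred k) : Prop :=
  ∀ M : Type, Nontrivial M → D M (∅ : Set (Fin k → M))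

/-- `D` is a first-order dependency: it is the class of models of a first-order
sentence over the signature `{R}`. -/
def FirstOrderDep {k : ℕ} (D : DepPred k) : Prop :=
  ∃ ψ : FOF (SigR k), IsSentence ψ ∧
    ∀ (M : Type), Nontrivial M → ∀ R : Set (Fin k → M),
      (D M R ↔ FOTrue M (interpR R) ψ)

/-- The interpretation of a unary predicate symbol as a subset of the domain. -/
def PSet {S : Signature} {M : Type} (I : Interp S M) (P : S 1) : Set M :=
  {m | (fun _ => m) ∈ I 1 P}

/-- Semantics of the relativization `D^(P)` of `D` to the unary predicate `P`:
`𝔐 ⊨_X D^(P) x̄` iff `(P^𝔐, X(x̄)) ∈ D`. -/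
def relSem {k : ℕ} (D : DepPred k) {S : Signature} (P : S 1)
    (M : Type) (I : Interp S M) (R : Set (Fin k → M)) : Prop :=
  (∀ f ∈ R, ∀ j, f j ∈ PSet I P) ∧
    D (↥(PSet I P)) {g : Fin k → ↥(PSet I P) | (fun j => (g j : M)) ∈ R}

/-- A family `𝒟` of generalized dependencies is strongly first order: every
sentence of `FO(𝒟)` is equivalent to some first-order sentence. -/
def SFOFam {ι : Type} {ar : ι → ℕ} (D : ∀ i, DepPred (ar i)) : Prop :=
  ∀ (S : Signature) (φ : TS S ι ar), IsSentence φ → Plain φ →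
    ∃ ψ : FOF S, IsSentence ψ ∧
      ∀ (M : Type), Nontrivial M → ∀ I : Interp S M,
        (TTrue M I (fun i => D i M) φ ↔ FOTrue M I ψ)

/-- A single dependency is strongly first order iff `{D}` is. -/
def SFOd {k : ℕ} (D : DepPred k) : Prop :=
  SFOFam (ι := Unit) (ar := fun _ => k) (fun _ => D)

/-- A family `𝒟` is relativizable: every sentence of `FO(𝒟^(P))` is equivalent
to some sentence of `FO(𝒟)`. -/
def RelativizableFam {ι : Type} {ar : ι → ℕ} (D : ∀ i, DepPred (ar i)) : Prop :=
  ∀ (S : Signature) (P : S 1) (φ : TS S ι ar), IsSentence φ → Plain φ →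
    ∃ ψ : TS S ι ar, IsSentence ψ ∧ Plain ψ ∧
      ∀ (M : Type), Nontrivial M → ∀ I : Interp S M,
        (TTrue M I (fun i => relSem (D i) P M I) φ ↔ TTrue M I (fun i => D i M) ψ)

def Relativizable1 {k : ℕ} (D : DepPred k) : Prop :=
  RelativizableFam (ι := Unit) (ar := fun _ => k) (fun _ => D)

/-- The family `𝒟 ∪ ∼𝒟`. -/
def withComplFam {ι : Type} {ar : ι → ℕ} (D : ∀ i, DepPred (ar i)) :
    ∀ i : ι ⊕ ι, DepPred (Sum.elim ar ar i) :=
  fun i => match i with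
    | .inl a => D a
    | .inr a => complD (D a)

/-- `D` is doubly strongly first order: `{D, ∼D}` is strongly first order. -/
def DSFOd {k : ℕ} (D : DepPred k) : Prop :=
  SFOFam (ι := Bool) (ar := fun _ => k)
    (fun b => match b with | true => D | false => complD D)

/-- The constancy atom of arity `k`. -/
def constD (k : ℕ) : DepPred k := fun _ R => ∀ f ∈ R, ∀ g ∈ R, f = g

/-- The totality atom of arity `k`. -/
def allD (k : ℕ) : DepPred k := fun M R => R = (Set.univ : Set (Fin k → M))

/-- The family `𝒟 ∪ {const}` (constancy atoms of every arity). -/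
def withConst {ι : Type} {ar : ι → ℕ} (D : ∀ i, DepPred (ar i)) :
    ∀ i : ι ⊕ ℕ, DepPred (Sum.elim ar id i) :=
  fun i => match i with
    | .inl a => D a
    | .inr n => constD n

/-- The atoms of `𝒟^(P) ∪ {const}`. -/
def withConstRel {ι : Type} {ar : ι → ℕ} (D : ∀ i, DepPred (ar i))
    {S : Signature} (P : S 1) (M : Type) (I : Interp S M) :
    ∀ i : ι ⊕ ℕ, Set (Fin (Sum.elim ar id i) → M) → Prop :=
  fun i => match i with
    | .inl a => relSem (D a) P M I
    | .inr n => constD n M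

/-- Atom indices of the logic `FO(𝒟₀, ⊔, const, All)`: the 0-ary first-order
dependencies `[ψ]`, the constancy atoms and the totality atoms. -/
inductive CIdx : Type
  | d0 (ψ : EF) (hψ : IsSentence ψ)
  | const (k : ℕ)
  | total (k : ℕ)

def cAr : CIdx → ℕ
  | .d0 _ _ => 0
  | .const k => k
  | .total k => k

def cSem (M : Type) : ∀ i : CIdx, Set (Fin (cAr i) → M) → Prop
  | .d0 ψ _, _ => FOTrue M (eI M) ψ
  | .const _, R => ∀ f ∈ R, ∀ g ∈ R, f = g
  | .total _, R => R = Set.univ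

/-- Embedding of first-order formulas over the empty signature into any
team logic. -/
def embedEF {S : Signature} {ι : Type} {ar : ι → ℕ} : EF → TS S ι ar
  | .rel r _ => Empty.elim r
  | .nrel r _ => Empty.elim r
  | .eq x y => .eq x y
  | .neq x y => .neq x y
  | .dep i _ => Empty.elim i
  | .and φ ψ => .and (embedEF φ) (embedEF ψ)
  | .or φ ψ => .or (embedEF φ) (embedEF ψ)
  | .gdisj φ ψ => .gdisj (embedEF φ) (embedEF ψ)
  | .cneg φ => .cneg (embedEF φ)
  | .ex v φ => .ex v (embedEF φ)
  | .al v φ => .al v (embedEF φ)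

/-- Override the values of the variables `0, …, k-1` by the tuple `f`. -/
def overrideFin {M : Type} (k : ℕ) (f : Fin k → M) (s : ℕ → M) : ℕ → M :=
  fun v => if h : v < k then f ⟨v, h⟩ else s v

/-- `(M, R) ⊨ ∃ȳ ∀x̄ (R x̄ → θ(x̄, ȳ))`, where `x̄` is the tuple of variables
`0, …, k-1` and the remaining free variables `ȳ` of `θ` are witnessed by `s`. -/
def ExAllSem {k : ℕ} (M : Type) (R : Set (Fin k → M)) (θ : EF) : Prop :=
  ∃ s : ℕ → M, ∀ f ∈ R, FSat M (eI M) (overrideFin k f s) θ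

/-- `(M, R) ⊨ ∃ȳ ∀x̄ (R x̄ ↔ θ(x̄, ȳ))`. -/
def ExAllIffSem {k : ℕ} (M : Type) (R : Set (Fin k → M)) (θ : EF) : Prop :=
  ∃ s : ℕ → M, ∀ f : Fin k → M, (f ∈ R ↔ FSat M (eI M) (overrideFin k f s) θ)

/-- The assignment sending `x̄ = (0, …, k-1)` to `f`, `ȳ = (k, …, k+n-1)` to
`a`, and every other variable to its value under `s0`. -/
def tupAsg {M : Type} (k n : ℕ) (f : Fin k → M) (a : Fin n → M) (s0 : ℕ → M) :
    ℕ → M :=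
  fun v => if h : v < k then f ⟨v, h⟩ else if h2 : v - k < n then a ⟨v - k, h2⟩ else s0 v

/-- `R` is defined by the formula `θ(x̄, ȳ)` (with `x̄ = (0, …, k-1)` and
`ȳ = (k, …, k+n-1)`): there is a tuple `ā` of parameters such that
`R = {m̄ : 𝔐 ⊨ θ(m̄, ā)}`. -/
def DefinedBy {S : Signature} {M : Type} (I : Interp S M) (k n : ℕ)
    (θ : FOF S) (R : Set (Fin k → M)) : Prop :=
  ∃ a : Fin n → M, ∀ s0 : ℕ → M, R = {f | FSat M I (tupAsg k n f a s0) θ}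

/-- `θ(x̄, ȳ)` fixes the identity type of `ȳ = (k, …, k+n-1)`. -/
def FixesIdType {S : Signature} (k n : ℕ) (θ : FOF S) : Prop :=
  ∀ i j : Fin n,
    (∀ (M : Type), Nontrivial M → ∀ (I : Interp S M) (s : ℕ → M),
        FSat M I s θ → s (k + (i : ℕ)) = s (k + (j : ℕ))) ∨
    (∀ (M : Type), Nontrivial M → ∀ (I : Interp S M) (s : ℕ → M),
        FSat M I s θ → s (k + (i : ℕ)) ≠ s (k + (j : ℕ)))

/-- `(M, R := Xv) ⊨ ∃ȳ ∀x̄ (R x̄ → θ(x̄, ȳ))` where the `x̄`-slots of `θ` are the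
variables `v̄` and the `ȳ`-slots are the variables `ȳ`. -/
def projExAll {M : Type} {k n : ℕ} (v : Fin k → ℕ) (y : Fin n → ℕ) (θ : EF)
    (Xv : Set (Fin k → M)) : Prop :=
  ∃ b : Fin n → M, ∀ f ∈ Xv, ∀ s : ℕ → M,
    (∀ j, s (v j) = f j) → (∀ i, s (y i) = b i) → FSat M (eI M) s θ

/-- Two finite tuples of the same equality type are conjugate under a permutation. -/
theorem exists_perm_comp_eq {α : Type*} {n : ℕ} (a b : Fin n → α)
    (h : ∀ i j, a i = a j ↔ b i = b j) : ∃ e : Equiv.Perm α, e ∘ a = b := by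
  have hspec : ∀ p : Set.range a, a p.2.choose = p := fun p => p.2.choose_spec
  let q := Finite.equivFin (Set.range a)
  let x : Fin (Nat.card (Set.range a)) ↪ α := q.symm.toEmbedding.trans (.subtype _)
  let y : Fin (Nat.card (Set.range a)) ↪ α :=
    ⟨fun i => b (q.symm i).2.choose, fun i j hij => by
      have := (h _ _).2 hij
      rw [hspec, hspec] at this
      exact q.symm.injective (Subtype.ext this)⟩
  obtain ⟨g, hg⟩ :=
    (Equiv.Perm.isMultiplyPretransitive α (Nat.card (Set.range a))).exists_smul_eq x y
  refine ⟨g, funext fun i => ?_⟩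
  let p : Set.range a := ⟨a i, i, rfl⟩
  have hx : x (q p) = a i := congrArg Subtype.val (q.symm_apply_apply p)
  have hy : y (q p) = b p.2.choose :=
    congrArg (fun r : Set.range a => b r.2.choose) (q.symm_apply_apply p)
  calc g (a i) = y (q p) := by rw [← hx, ← hg]; rfl
    _ = b i := hy.trans ((h _ _).1 (hspec p))

/-- Satisfaction over the empty signature is invariant under permutations of the domain. -/
theorem fsat_perm_comp {M : Type} (e : Equiv.Perm M) (θ : EF) (s : ℕ → M) :
    FSat M (eI M) (e ∘ s) θ ↔ FSat M (eI M) s θ := by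
  induction θ generalizing s with
  | rel r v => exact Empty.elim r
  | nrel r v => exact Empty.elim r
  | eq x y => simp [FSat]
  | neq x y => simp [FSat]
  | dep i v => exact Empty.elim i
  | and φ ψ hφ hψ => simp only [FSat, hφ, hψ]
  | or φ ψ hφ hψ => simp only [FSat, hφ, hψ]
  | gdisj φ ψ hφ hψ => simp only [FSat, hφ, hψ]
  | cneg φ hφ => simp only [FSat, hφ]
  | ex v φ hφ =>
    simp only [FSat]
    rw [← e.exists_congr_right]
    simp only [← Function.comp_update, hφ]
  | al v φ hφ =>
    simp only [FSat]
    rw [← e.forall_congr_right]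
    simp only [← Function.comp_update, hφ]

theorem comp_tupAsg {M N : Type} (e : M → N) (k n : ℕ) (f : Fin k → M) (a : Fin n → M)
    (s : ℕ → M) : e ∘ tupAsg k n f a s = tupAsg k n (e ∘ f) (e ∘ a) (e ∘ s) := by
  funext v
  simp only [tupAsg, Function.comp_apply]
  split_ifs <;> rfl

theorem tupAsg_add {M : Type} (k n : ℕ) (f : Fin k → M) (a : Fin n → M) (s : ℕ → M)
    (i : Fin n) : tupAsg k n f a s (k + i) = a i := by
  simp [tupAsg]

/-- Parameter tuples satisfying a formula that fixes their identity type have the same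
equality type. -/
theorem FixesIdType.param_eq_iff {S : Signature} {k n : ℕ} {θ : FOF S}
    (h : FixesIdType k n θ) {M : Type} [Nontrivial M] {I : Interp S M} {f g : Fin k → M}
    {a b : Fin n → M} {s t : ℕ → M} (hf : FSat M I (tupAsg k n f a s) θ)
    (hg : FSat M I (tupAsg k n g b t) θ) (i j : Fin n) : a i = a j ↔ b i = b j := by
  rcases h i j with h | h
  all_goals
    have h₁ := h M ‹_› I _ hf
    have h₂ := h M ‹_› I _ hg
    simp only [tupAsg_add] at h₁ h₂
    simp [h₁, h₂]

/-- If two nonempty relations `R` and `S` over the same model are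
defined by the same first-order formula `θ(x̄, ȳ)` over the empty signature,
and `θ` fixes the identity type of `ȳ`, then there is a bijection `h : M → M`
mapping `R` onto `S` (componentwise). -/
theorem same_defining_formula_gives_bijection (M : Type) [Nontrivial M]
    (k n : ℕ) (θ : EF) (hfv : fv θ ⊆ {v | v < k + n})
    (hfix : FixesIdType k n θ) (R S : Set (Fin k → M))
    (hR : R.Nonempty) (hS : S.Nonempty)
    (hdR : DefinedBy (eI M) k n θ R) (hdS : DefinedBy (eI M) k n θ S) :
    ∃ h : M → M, Function.Bijective h ∧ (fun f => h ∘ f) '' R = S := by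
  obtain ⟨f₀, hf₀⟩ := hR
  obtain ⟨g₀, hg₀⟩ := hS
  obtain ⟨a, ha⟩ := hdR
  obtain ⟨b, hb⟩ := hdS
  obtain ⟨s⟩ : Nonempty (ℕ → M) := inferInstance
  have hab : ∀ i j, a i = a j ↔ b i = b j :=
    hfix.param_eq_iff (ha s ▸ hf₀ : f₀ ∈ {f | FSat M (eI M) (tupAsg k n f a s) θ})
      (hb s ▸ hg₀ : g₀ ∈ {f | FSat M (eI M) (tupAsg k n f b s) θ})
  obtain ⟨e, rfl⟩ := exists_perm_comp_eq a b hab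
  have key : ∀ f : Fin k → M, e ∘ f ∈ S ↔ f ∈ R := fun f => by
    rw [ha s, hb (e ∘ s), Set.mem_ofPred_eq, Set.mem_ofPred_eq, ← comp_tupAsg, fsat_perm_comp]
  refine ⟨e, e.bijective, Set.ext fun g => ⟨?_, fun hg => ?_⟩⟩
  · rintro ⟨f, hf, rfl⟩
    exact (key f).2 hf
  · have he : e ∘ (e.symm ∘ g) = g := by ext; simp
    exact ⟨e.symm ∘ g, (key _).1 (he.symm ▸ hg), he⟩

end DSFO
end

section
/- Let 𝒟 be a strongly first order family of downwards closed generalized dependencies. Then 𝒟 is doubly strongly first order, i.e., 𝒟 ∪ ∼𝒟 is strongly first order. -/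
namespace DSFO

/-- Push `m` on top of the stack of values `s`. -/
def cons {M : Type} (m : M) (s : ℕ → M) : ℕ → M
  | 0 => m
  | n + 1 => s n

/-- Uniform predicates on assignments, depending on a structure and on a family of relations
indexed by `σ`. -/
abbrev Pred (S : Signature) (σ : Type) (ak : σ → ℕ) :=
  ∀ M : Type, Interp S M → (∀ x : σ, Set (Fin (ak x) → M)) → (ℕ → M) → Prop

/-- Predicates definable by first-order formulas in which the relations indexed by `Λ` occur
only positively and no other indexed relation occurs. -/
inductive PD {S : Signature} {σ : Type} {ak : σ → ℕ} (Λ : Set σ) : Pred S σ ak → Prop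
  | rel {k : ℕ} (r : S k) (v : Fin k → ℕ) : PD Λ (fun _ I _ s => (fun i => s (v i)) ∈ I _ r)
  | nrel {k : ℕ} (r : S k) (v : Fin k → ℕ) : PD Λ (fun _ I _ s => (fun i => s (v i)) ∉ I _ r)
  | eq (x y : ℕ) : PD Λ (fun _ _ _ s => s x = s y)
  | neq (x y : ℕ) : PD Λ (fun _ _ _ s => s x ≠ s y)
  | atom (x : σ) (hx : x ∈ Λ) (v : Fin (ak x) → ℕ) :
      PD Λ (fun _ _ E s => (fun i => s (v i)) ∈ E x)
  | and {P Q : Pred S σ ak} : PD Λ P → PD Λ Q → PD Λ (fun M I E s => P M I E s ∧ Q M I E s)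
  | or {P Q : Pred S σ ak} : PD Λ P → PD Λ Q → PD Λ (fun M I E s => P M I E s ∨ Q M I E s)
  | ex {P : Pred S σ ak} : PD Λ P → PD Λ (fun M I E s => ∃ m, P M I E (cons m s))
  | al {P : Pred S σ ak} : PD Λ P → PD Λ (fun M I E s => ∀ m, P M I E (cons m s))
  | congr {P Q : Pred S σ ak} : PD Λ P →
      (∀ (M : Type), Nontrivial M → ∀ I E s, P M I E s ↔ Q M I E s) → PD Λ Q

namespace PD

variable {S : Signature} {σ : Type} {ak : σ → ℕ} {Λ : Set σ} {P Q : Pred S σ ak}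

theorem rename (h : PD Λ P) (f : ℕ → ℕ) : PD Λ (fun M I E s => P M I E (fun n => s (f n))) := by
  have lift : ∀ (f : ℕ → ℕ) (M : Type) (s : ℕ → M) (m : M),
      (fun n => cons m s (cons 0 (fun n => f n + 1) n)) = cons m (fun n => s (f n)) := by
    intro f M s m
    funext n
    cases n <;> rfl
  induction h generalizing f with
  | rel r v => exact .rel r _
  | nrel r v => exact .nrel r _
  | eq x y => exact .eq _ _
  | neq x y => exact .neq _ _
  | atom x hx v => exact .atom x hx _
  | and _ _ ih1 ih2 => exact .and (ih1 f) (ih2 f)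
  | or _ _ ih1 ih2 => exact .or (ih1 f) (ih2 f)
  | ex _ ih =>
    refine .congr (.ex (ih (cons 0 (fun n => f n + 1)))) fun M _ I E s => ?_
    simp only [lift]
  | al _ ih =>
    refine .congr (.al (ih (cons 0 (fun n => f n + 1)))) fun M _ I E s => ?_
    simp only [lift]
  | congr _ h ih => exact .congr (ih f) fun M hM I E s => h M hM I E _

theorem update_eq_cons {M : Type} (s : ℕ → M) (v : ℕ) (m : M) :
    (fun n => cons m s (if n = v then 0 else n + 1)) = Function.update s v m := by
  funext n
  by_cases hn : n = v
  · subst hn; simp [cons]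
  · simp [cons, hn]

theorem exNamed (h : PD Λ P) (v : ℕ) :
    PD Λ (fun M I E s => ∃ m, P M I E (Function.update s v m)) := by
  refine .congr (.ex (h.rename (fun n => if n = v then 0 else n + 1))) fun M _ I E s => ?_
  simp only [update_eq_cons]

theorem alNamed (h : PD Λ P) (v : ℕ) :
    PD Λ (fun M I E s => ∀ m, P M I E (Function.update s v m)) := by
  refine .congr (.al (h.rename (fun n => if n = v then 0 else n + 1))) fun M _ I E s => ?_
  simp only [update_eq_cons]

theorem true_pd : PD Λ (fun _ _ _ _ => True : Pred S σ ak) :=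
  .congr (.eq 0 0) fun _ _ _ _ _ => by simp

theorem false_pd : PD Λ (fun _ _ _ _ => False : Pred S σ ak) :=
  .congr (.neq 0 0) fun _ _ _ _ _ => by simp

theorem all_list (T : List (Pred S σ ak)) (h : ∀ P ∈ T, PD Λ P) :
    PD Λ (fun M I E s => ∀ P ∈ T, P M I E s) := by
  induction T with
  | nil => exact .congr true_pd fun _ _ _ _ _ => by simp
  | cons P T ih =>
    simp only [List.mem_cons, forall_eq_or_imp] at h ⊢
    exact .and h.1 (ih h.2)

theorem any_list (T : List (Pred S σ ak)) (h : ∀ P ∈ T, PD Λ P) :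
    PD Λ (fun M I E s => ∃ P ∈ T, P M I E s) := by
  induction T with
  | nil => exact .congr false_pd fun _ _ _ _ _ => by simp
  | cons P T ih =>
    simp only [List.mem_cons, forall_eq_or_imp, exists_eq_or_imp] at h ⊢
    exact .or h.1 (ih h.2)

theorem all_fin {k : ℕ} (T : Fin k → Pred S σ ak) (h : ∀ i, PD Λ (T i)) :
    PD Λ (fun M I E s => ∀ i, T i M I E s) := by
  refine .congr (all_list (List.ofFn T) ?_) fun M _ I E s => ?_
  · simpa using h
  · simp

theorem exists_support (h : PD Λ P) : ∃ B : ℕ, ∀ (M : Type), Nontrivial M → ∀ I E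
    (s s' : ℕ → M), (∀ n < B, s n = s' n) → (P M I E s ↔ P M I E s') := by
  have bd : ∀ {k : ℕ} (v : Fin k → ℕ), ∃ B, ∀ i, v i < B := fun v =>
    ⟨Finset.univ.sup v + 1, fun i => Nat.lt_succ_of_le (Finset.le_sup (Finset.mem_univ i))⟩
  have quant : ∀ {M : Type} {B : ℕ} {s s' : ℕ → M} (m : M), (∀ n < B, s n = s' n) →
      ∀ n < B, cons m s n = cons m s' n := by
    intro M B s s' m h n hn
    cases n with
    | zero => rfl
    | succ n => exact h n (by omega)
  induction h with
  | rel r v =>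
    obtain ⟨B, hB⟩ := bd v
    exact ⟨B, fun M _ I E s s' h => by simp only [h _ (hB _)]⟩
  | nrel r v =>
    obtain ⟨B, hB⟩ := bd v
    exact ⟨B, fun M _ I E s s' h => by simp only [h _ (hB _)]⟩
  | eq x y => exact ⟨x + y + 1, fun M _ I E s s' h => by
      simp only [h x (by omega), h y (by omega)]⟩
  | neq x y => exact ⟨x + y + 1, fun M _ I E s s' h => by
      simp only [h x (by omega), h y (by omega)]⟩
  | atom x hx v =>
    obtain ⟨B, hB⟩ := bd v
    exact ⟨B, fun M _ I E s s' h => by simp only [h _ (hB _)]⟩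
  | and _ _ ih1 ih2 =>
    obtain ⟨B, hB⟩ := ih1
    obtain ⟨C, hC⟩ := ih2
    exact ⟨B + C, fun M hM I E s s' h => and_congr
      (hB M hM I E s s' fun n hn => h n (by omega)) (hC M hM I E s s' fun n hn => h n (by omega))⟩
  | or _ _ ih1 ih2 =>
    obtain ⟨B, hB⟩ := ih1
    obtain ⟨C, hC⟩ := ih2
    exact ⟨B + C, fun M hM I E s s' h => or_congr
      (hB M hM I E s s' fun n hn => h n (by omega)) (hC M hM I E s s' fun n hn => h n (by omega))⟩
  | ex _ ih =>
    obtain ⟨B, hB⟩ := ih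
    exact ⟨B, fun M hM I E s s' h => exists_congr fun m => hB M hM I E _ _ (quant m h)⟩
  | al _ ih =>
    obtain ⟨B, hB⟩ := ih
    exact ⟨B, fun M hM I E s s' h => forall_congr' fun m => hB M hM I E _ _ (quant m h)⟩
  | congr _ h ih =>
    obtain ⟨B, hB⟩ := ih
    exact ⟨B, fun M hM I E s s' h' => by rw [← h M hM, ← h M hM, hB M hM I E s s' h']⟩

theorem exBlock (h : PD Λ P) (N : ℕ) : PD Λ (fun M I E s =>
    ∃ z : ℕ → M, P M I E (fun n => if n < N then z n else s (n - N))) := by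
  induction N generalizing P with
  | zero =>
    refine .congr h fun M _ I E s => ?_
    have : Nonempty (ℕ → M) := ⟨s⟩
    simp
  | succ N ih =>
    refine .congr (ih (.ex h)) fun M _ I E s => ?_
    have key : ∀ (z : ℕ → M) (m : M), cons m (fun n => if n < N then z n else s (n - N)) =
        fun n => if n < N + 1 then cons m z n else s (n - (N + 1)) := by
      intro z m
      funext n
      cases n <;> simp [cons]
    constructor
    · rintro ⟨z, m, h⟩
      exact ⟨cons m z, by rwa [← key]⟩
    · rintro ⟨z, h⟩
      refine ⟨fun n => z (n + 1), z 0, ?_⟩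
      rw [key]
      convert h using 4 with n
      cases n <;> rfl

theorem mem_teamProj (h : PD Λ P) {k : ℕ} (v w : Fin k → ℕ) :
    PD Λ (fun M I E s => (fun i => s (w i)) ∈ teamProj v {z | P M I E z}) := by
  obtain ⟨B, hB⟩ := h.exists_support
  set N := B + (Finset.univ.sup v + 1) with hN
  have hv : ∀ i, v i < N := fun i => by
    have := Finset.le_sup (f := v) (Finset.mem_univ i)
    omega
  refine .congr (exBlock (.and h (all_fin (fun i _ _ _ u => u (w i + N) = u (v i))
    fun i => .eq _ _)) N) fun M hM I E s => ?_
  constructor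
  · rintro ⟨z, hz, hzw⟩
    refine ⟨z, (hB M hM I E _ _ fun n hn => ?_).1 hz, funext fun i => ?_⟩
    · rw [if_pos (by omega)]
    · simpa [hv i] using hzw i
  · rintro ⟨z, hz, hzw⟩
    refine ⟨z, (hB M hM I E _ _ fun n hn => ?_).1 hz, fun i => ?_⟩
    · rw [if_pos (by omega)]
    · simpa [hv i] using congrFun hzw i

theorem subst {k : ℕ} {Λ' : Set Unit} {χ : Pred Sig0 Unit (fun _ => k)} (hχ : PD Λ' χ)
    (R : ∀ M : Type, Interp S M → (∀ x : σ, Set (Fin (ak x) → M)) → Set (Fin k → M))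
    (hR : ∀ w : Fin k → ℕ, PD Λ (fun M I E s => (fun i => s (w i)) ∈ R M I E)) :
    PD Λ (fun M I E s => χ M (eI M) (fun _ => R M I E) s) := by
  induction hχ with
  | rel r v => exact Empty.elim r
  | nrel r v => exact Empty.elim r
  | eq x y => exact .eq _ _
  | neq x y => exact .neq _ _
  | atom x hx v => exact hR v
  | and _ _ ih1 ih2 => exact .and ih1 ih2
  | or _ _ ih1 ih2 => exact .or ih1 ih2
  | ex _ ih => exact .ex ih
  | al _ ih => exact .al ih
  | congr _ h ih => exact .congr ih fun M hM I E s => h M hM _ _ s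

end PD

section FreeVariables

variable {S : Signature} {ι : Type} {ar : ι → ℕ}

theorem FSat_congr {M : Type} (I : Interp S M) (φ : TS S ι ar) :
    ∀ s s' : ℕ → M, (∀ x ∈ fv φ, s x = s' x) → (FSat M I s φ ↔ FSat M I s' φ) := by
  have quant : ∀ {φ : TS S ι ar} {v : ℕ} {s s' : ℕ → M} (m : M),
      (∀ x ∈ fv φ \ {v}, s x = s' x) →
      ∀ x ∈ fv φ, Function.update s v m x = Function.update s' v m x := by
    intro φ v s s' m h x hx
    by_cases hxv : x = v
    · subst hxv; simp
    · simpa [hxv] using h x ⟨hx, hxv⟩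
  induction φ with
  | rel r v =>
    intro s s' h
    have : (fun i => s (v i)) = fun i => s' (v i) := funext fun i => h _ ⟨i, rfl⟩
    simp only [FSat, this]
  | nrel r v =>
    intro s s' h
    have : (fun i => s (v i)) = fun i => s' (v i) := funext fun i => h _ ⟨i, rfl⟩
    simp only [FSat, this]
  | eq x y =>
    intro s s' h
    simp only [FSat, h x (by simp [fv]), h y (by simp [fv])]
  | neq x y =>
    intro s s' h
    simp only [FSat, h x (by simp [fv]), h y (by simp [fv])]
  | dep i v => exact fun _ _ _ => Iff.rfl
  | and φ ψ ih1 ih2 =>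
    exact fun s s' h => and_congr (ih1 s s' fun x hx => h x (.inl hx))
      (ih2 s s' fun x hx => h x (.inr hx))
  | or φ ψ ih1 ih2 =>
    exact fun s s' h => or_congr (ih1 s s' fun x hx => h x (.inl hx))
      (ih2 s s' fun x hx => h x (.inr hx))
  | gdisj φ ψ ih1 ih2 =>
    exact fun s s' h => or_congr (ih1 s s' fun x hx => h x (.inl hx))
      (ih2 s s' fun x hx => h x (.inr hx))
  | cneg φ ih => exact fun s s' h => not_congr (ih s s' h)
  | ex v φ ih => exact fun s s' h => exists_congr fun m => ih _ _ (quant m h)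
  | al v φ ih => exact fun s s' h => forall_congr' fun m => ih _ _ (quant m h)

theorem fv_finite (φ : TS S ι ar) : (fv φ).Finite := by
  induction φ with
  | rel r v => exact Set.finite_range v
  | nrel r v => exact Set.finite_range v
  | eq x y => exact Set.toFinite {x, y}
  | neq x y => exact Set.toFinite {x, y}
  | dep i v => exact Set.finite_range v
  | and φ ψ ih1 ih2 => exact ih1.union ih2
  | or φ ψ ih1 ih2 => exact ih1.union ih2
  | gdisj φ ψ ih1 ih2 => exact ih1.union ih2
  | cneg φ ih => exact ih
  | ex v φ ih => exact ih.subset Set.sdiff_subset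
  | al v φ ih => exact ih.subset Set.sdiff_subset

/-- The pairs `(v, θ)` such that evaluating the formula requires deciding `∃ v θ`. -/
def witnessPairs : TS S ι ar → List (ℕ × TS S ι ar)
  | .and φ ψ => witnessPairs φ ++ witnessPairs ψ
  | .or φ ψ => witnessPairs φ ++ witnessPairs ψ
  | .gdisj φ ψ => witnessPairs φ ++ witnessPairs ψ
  | .cneg φ => witnessPairs φ
  | .ex v φ => (v, φ) :: witnessPairs φ
  | .al v φ => (v, .cneg φ) :: witnessPairs φ
  | _ => []

end FreeVariables

/-- A Łoś theorem for the quotient of an index set of elements of the ultraproduct, provided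
that this index set contains enough witnesses. -/
theorem FSat_limit {ι : Type} {ar : ι → ℕ} {k : ℕ} (U : Ultrafilter ℕ) (M : ℕ → Type)
    (R : ∀ n, Set (Fin k → M n)) (a : ∀ n, ℕ → M n) {Q : Type} (π : ℕ → Q)
    (hsurj : Function.Surjective π) (hπ : ∀ i j, π i = π j ↔ ∀ᶠ n in (U : Filter ℕ), a n i = a n j)
    (R₀ : Set (Fin k → Q))
    (hR₀ : ∀ w : Fin k → ℕ, (fun l => π (w l)) ∈ R₀ ↔
      ∀ᶠ n in (U : Filter ℕ), (fun l => a n (w l)) ∈ R n)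
    (φ : TS (SigR k) ι ar)
    (hw : ∀ p ∈ witnessPairs φ, ∀ σ : ℕ → ℕ,
      (∀ᶠ n in (U : Filter ℕ), ∃ m, FSat (M n) (interpR (R n))
        (Function.update (fun x => a n (σ x)) p.1 m) p.2) →
      ∃ j, ∀ᶠ n in (U : Filter ℕ), FSat (M n) (interpR (R n))
        (Function.update (fun x => a n (σ x)) p.1 (a n j)) p.2) :
    ∀ σ : ℕ → ℕ, FSat Q (interpR R₀) (fun x => π (σ x)) φ ↔
      ∀ᶠ n in (U : Filter ℕ), FSat (M n) (interpR (R n)) (fun x => a n (σ x)) φ := by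
  have upd : ∀ {X : Type} (f : ℕ → X) (σ : ℕ → ℕ) (v j : ℕ),
      Function.update (fun x => f (σ x)) v (f j) = fun x => f (Function.update σ v j x) := by
    intro X f σ v j
    funext x
    by_cases h : x = v
    · subst h; simp
    · simp [h]
  induction φ with
  | rel r v => exact fun σ => hR₀ fun l => σ (v _)
  | nrel r v =>
    exact fun σ => (not_congr (hR₀ fun l => σ (v _))).trans Ultrafilter.eventually_not.symm
  | eq x y => exact fun σ => hπ _ _
  | neq x y => exact fun σ => (not_congr (hπ _ _)).trans Ultrafilter.eventually_not.symm
  | dep i v => exact fun σ => by simp [FSat]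
  | and φ ψ ih1 ih2 =>
    intro σ
    have h1 := ih1 (fun p hp => hw p (List.mem_append_left _ hp)) σ
    have h2 := ih2 (fun p hp => hw p (List.mem_append_right _ hp)) σ
    exact (and_congr h1 h2).trans Filter.eventually_and.symm
  | or φ ψ ih1 ih2 =>
    intro σ
    have h1 := ih1 (fun p hp => hw p (List.mem_append_left _ hp)) σ
    have h2 := ih2 (fun p hp => hw p (List.mem_append_right _ hp)) σ
    exact (or_congr h1 h2).trans Ultrafilter.eventually_or.symm
  | gdisj φ ψ ih1 ih2 =>
    intro σ
    have h1 := ih1 (fun p hp => hw p (List.mem_append_left _ hp)) σ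
    have h2 := ih2 (fun p hp => hw p (List.mem_append_right _ hp)) σ
    exact (or_congr h1 h2).trans Ultrafilter.eventually_or.symm
  | cneg φ ih =>
    exact fun σ => (not_congr (ih hw σ)).trans Ultrafilter.eventually_not.symm
  | ex v φ ih =>
    intro σ
    have ih := ih fun p hp => hw p (List.mem_cons_of_mem _ hp)
    constructor
    · rintro ⟨m, hm⟩
      obtain ⟨j, rfl⟩ := hsurj m
      rw [upd, ih] at hm
      filter_upwards [hm] with n hn
      exact ⟨a n j, by rwa [upd]⟩
    · intro h
      obtain ⟨j, hj⟩ := hw (v, φ) List.mem_cons_self σ h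
      refine ⟨π j, ?_⟩
      rw [upd, ih]
      simpa only [upd] using hj
  | al v φ ih =>
    intro σ
    have ih := ih fun p hp => hw p (List.mem_cons_of_mem _ hp)
    constructor
    · intro h
      by_contra hcon
      rw [← Ultrafilter.eventually_not] at hcon
      obtain ⟨j, hj⟩ := hw (v, .cneg φ) List.mem_cons_self σ (by
        filter_upwards [hcon] with n hn
        simpa [FSat] using hn)
      have hm := h (π j)
      rw [upd, ih] at hm
      obtain ⟨n, h1, h2⟩ := (hj.and hm).exists
      simp only [upd] at h1
      exact h1 h2
    · intro h m
      obtain ⟨j, rfl⟩ := hsurj m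
      rw [upd, ih]
      filter_upwards [h] with n hn
      have := hn (a n j)
      rwa [upd] at this

section Game

variable {k : ℕ} {M N : Type}

/-- On the first `t` entries, `s ↦ s'` is a partial injection preserving the relation. -/
def AtomicLE (R : Set (Fin k → M)) (R' : Set (Fin k → N)) (t : ℕ) (s : ℕ → M) (s' : ℕ → N) :
    Prop :=
  (∀ i < t, ∀ j < t, (s i = s j ↔ s' i = s' j)) ∧
    ∀ v : Fin k → ℕ, (∀ l, v l < t) → (fun l => s (v l)) ∈ R → (fun l => s' (v l)) ∈ R'

/-- Duplicator survives `n` more rounds of the positive back-and-forth game after `t` rounds. -/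
def Game (R : Set (Fin k → M)) (R' : Set (Fin k → N)) : ℕ → ℕ → (ℕ → M) → (ℕ → N) → Prop
  | 0, t, s, s' => AtomicLE R R' t s s'
  | n + 1, t, s, s' => AtomicLE R R' t s s' ∧
      (∀ m, ∃ m', Game R R' n (t + 1) (Function.update s t m) (Function.update s' t m')) ∧
      ∀ m', ∃ m, Game R R' n (t + 1) (Function.update s t m) (Function.update s' t m')

theorem Game.play {R : Set (Fin k → M)} {R' : Set (Fin k → N)} (side : ℕ → Bool)
    (cl : ℕ → (ℕ → M) → M) (cr : ℕ → (ℕ → N) → N)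
    (hcl : ∀ j a a', (∀ i < j, a i = a' i) → cl j a = cl j a')
    (hcr : ∀ j a a', (∀ i < j, a i = a' i) → cr j a = cr j a') :
    ∀ (n t : ℕ) (s : ℕ → M) (s' : ℕ → N), Game R R' n t s s' →
      ∃ (a : ℕ → M) (b : ℕ → N), (∀ i < t, a i = s i ∧ b i = s' i) ∧
        AtomicLE R R' (t + n) a b ∧
        ∀ j, t ≤ j → j < t + n → (side j = true → a j = cl j a) ∧
          (side j = false → b j = cr j b)
  | 0, t, s, s', h => ⟨s, s', fun _ _ => ⟨rfl, rfl⟩, h, fun j h1 h2 => by omega⟩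
  | n + 1, t, s, s', h => by
    obtain ⟨-, hf, hb⟩ := h
    obtain ⟨m, m', hg, hm⟩ : ∃ m m',
        Game R R' n (t + 1) (Function.update s t m) (Function.update s' t m') ∧
        (side t = true → m = cl t s) ∧ (side t = false → m' = cr t s') := by
      cases hside : side t with
      | true =>
        obtain ⟨m', h⟩ := hf (cl t s)
        exact ⟨_, m', h, by simp⟩
      | false =>
        obtain ⟨m, h⟩ := hb (cr t s')
        exact ⟨m, _, h, by simp⟩
    obtain ⟨a, b, h1, h2, h3⟩ := Game.play side cl cr hcl hcr n (t + 1) _ _ hg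
    have ha : ∀ i < t, a i = s i ∧ b i = s' i := by
      intro i hi
      have := h1 i (by omega)
      simpa [hi.ne] using this
    have hat : a t = m ∧ b t = m' := by simpa using h1 t (by omega)
    refine ⟨a, b, ha, by rwa [Nat.add_right_comm, Nat.add_assoc] at h2, fun j hj1 hj2 => ?_⟩
    rcases hj1.eq_or_lt with rfl | hlt
    · rw [hat.1, hat.2, hcl t a s fun i hi => (ha i hi).1, hcr t b s' fun i hi => (ha i hi).2]
      exact hm
    · exact h3 j hlt (by omega)

/-- The atomic positive predicates in the first `t` variables. -/
noncomputable def posBase (k t : ℕ) : List (Pred Sig0 Unit (fun _ => k)) :=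
  ((List.range t ×ˢ List.range t).map fun p => fun _ _ _ s => s p.1 = s p.2) ++
  ((List.range t ×ˢ List.range t).map fun p => fun _ _ _ s => s p.1 ≠ s p.2) ++
  ((Finset.univ : Finset (Fin k → Fin t)).toList.map
    fun v => fun _ _ E s => (fun l => s (v l : ℕ)) ∈ E ())

/-- Positive predicates of quantifier rank at most `n` in the first `t` variables. -/
noncomputable def posList (k : ℕ) : ℕ → ℕ → List (Pred Sig0 Unit (fun _ => k))
  | 0, t => posBase k t
  | n + 1, t => posBase k t ++
      ((posList k n (t + 1)).sublists.map fun T => fun M I E s =>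
        ∃ m, ∀ P ∈ T, P M I E (Function.update s t m)) ++
      ((posList k n (t + 1)).sublists.map fun T => fun M I E s =>
        ∀ m, ∃ P ∈ T, P M I E (Function.update s t m))

theorem posBase_pd (t : ℕ) : ∀ P ∈ posBase k t, PD Set.univ P := by
  intro P hP
  simp only [posBase, List.mem_append, List.mem_map] at hP
  rcases hP with (⟨p, -, rfl⟩ | ⟨p, -, rfl⟩) | ⟨v, -, rfl⟩
  · exact .eq _ _
  · exact .neq _ _
  · exact PD.atom (ak := fun _ : Unit => k) (Λ := Set.univ) () (Set.mem_univ _) fun l => (v l : ℕ)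

theorem posList_pd (n : ℕ) : ∀ t, ∀ P ∈ posList k n t, PD Set.univ P := by
  induction n with
  | zero => exact posBase_pd
  | succ n ih =>
    intro t P hP
    simp only [posList, List.mem_append, List.mem_map, List.mem_sublists] at hP
    rcases hP with (hP | ⟨T, hT, rfl⟩) | ⟨T, hT, rfl⟩
    · exact posBase_pd t P hP
    · exact (PD.all_list T fun P hP => ih _ P (hT.subset hP)).exNamed t
    · exact (PD.any_list T fun P hP => ih _ P (hT.subset hP)).alNamed t

theorem atomicLE_of_posBase {R : Set (Fin k → M)} {R' : Set (Fin k → N)} {t : ℕ} {s : ℕ → M}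
    {s' : ℕ → N} (h : ∀ P ∈ posBase k t, P M (eI M) (fun _ => R) s → P N (eI N) (fun _ => R') s') :
    AtomicLE R R' t s s' := by
  simp only [posBase, List.mem_append] at h
  refine ⟨fun i hi j hj => ⟨fun heq => ?_, fun heq => ?_⟩, fun v hv hR => ?_⟩
  · exact h _ (.inl (.inl (List.mem_map.2 ⟨(i, j), by simp [hi, hj], rfl⟩))) heq
  · by_contra hne
    exact h _ (.inl (.inr (List.mem_map.2 ⟨(i, j), by simp [hi, hj], rfl⟩))) hne heq
  · exact h _ (.inr (List.mem_map.2 ⟨fun l => ⟨v l, hv l⟩, by simp, rfl⟩)) hR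

open Classical in
theorem game_of_posList {R : Set (Fin k → M)} {R' : Set (Fin k → N)} (n : ℕ) :
    ∀ (t : ℕ) (s : ℕ → M) (s' : ℕ → N),
      (∀ P ∈ posList k n t, P M (eI M) (fun _ => R) s → P N (eI N) (fun _ => R') s') →
      Game R R' n t s s' := by
  induction n with
  | zero => exact fun t s s' h => atomicLE_of_posBase h
  | succ n ih =>
    intro t s s' h
    simp only [posList, List.mem_append] at h
    refine ⟨atomicLE_of_posBase fun P hP => h P (.inl (.inl hP)), fun m => ?_, fun m' => ?_⟩
    · obtain ⟨m', hm'⟩ := h _ (.inl (.inr (List.mem_map.2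
        ⟨(posList k n (t + 1)).filter fun P => P M (eI M) (fun _ => R) (Function.update s t m),
          List.mem_sublists.2 List.filter_sublist, rfl⟩)))
        ⟨m, fun P hP => by simpa using (List.mem_filter.1 hP).2⟩
      exact ⟨m', ih _ _ _ fun P hP hPm => hm' P (List.mem_filter.2 ⟨hP, by simpa using hPm⟩)⟩
    · by_contra hcon
      have key := h _ (.inr (List.mem_map.2
        ⟨(posList k n (t + 1)).filter
            fun P => ¬ P N (eI N) (fun _ => R') (Function.update s' t m'),
          List.mem_sublists.2 List.filter_sublist, rfl⟩)) fun m => by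
            by_contra hm
            refine hcon ⟨m, ih _ _ _ fun P hP hPm => ?_⟩
            by_contra hPn
            exact hm ⟨P, List.mem_filter.2 ⟨hP, by simpa using hPn⟩, hPm⟩
      obtain ⟨P, hP, hPm⟩ := key m'
      exact absurd hPm (by simpa using (List.mem_filter.1 hP).2)

end Game

section Lyndon

variable {k : ℕ}

theorem FOTrue_iff_of_isSentence {S : Signature} {ι : Type} {ar : ι → ℕ} {M : Type}
    (I : Interp S M) {φ : TS S ι ar} (hφ : IsSentence φ) (s : ℕ → M) :
    FOTrue M I φ ↔ FSat M I s φ :=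
  ⟨fun h => h s, fun h s' => (FSat_congr I φ s s' fun x hx => by
    rw [show fv φ = ∅ from hφ] at hx; exact hx.elim).1 h⟩

/-- A bookkeeping function in which every value occurs infinitely often. -/
def task (j : ℕ) : Bool × ℕ × List ℕ := (Encodable.decode (Nat.unpair j).1).getD (true, 0, [])

open Classical in
/-- A witness for the task scheduled at step `j`, if there is one. -/
noncomputable def pick {M : Type} [Nonempty M] (R : Set (Fin k → M))
    (L : List (ℕ × FOF (SigR k))) (j : ℕ) (a : ℕ → M) : M :=
  Classical.epsilon fun m => (∀ x, (task j).2.2.getD x 0 < j) ∧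
    FSat M (interpR R) (Function.update (fun x => a ((task j).2.2.getD x 0))
      (L.getD (task j).2.1 (0, .top)).1 m) (L.getD (task j).2.1 (0, .top)).2

theorem pick_congr {M : Type} [Nonempty M] (R : Set (Fin k → M)) (L : List (ℕ × FOF (SigR k)))
    (j : ℕ) (a a' : ℕ → M) (h : ∀ i < j, a i = a' i) : pick R L j a = pick R L j a' := by
  unfold pick
  congr 1
  funext m
  refine propext (and_congr_right fun hlt => ?_)
  rw [show (fun x => a ((task j).2.2.getD x 0)) = fun x => a' ((task j).2.2.getD x 0) from
    funext fun x => h _ (hlt x)]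

theorem exists_pick_spec (b : Bool) (L : List (ℕ × FOF (SigR k))) (p : ℕ × FOF (SigR k))
    (hp : p ∈ L) (σ : ℕ → ℕ) :
    ∃ j, (task j).1 = b ∧ ∀ (M : Type) [Nonempty M] (R : Set (Fin k → M)) (a : ℕ → M),
      a j = pick R L j a →
      (∃ m, FSat M (interpR R) (Function.update (fun x => a (σ x)) p.1 m) p.2) →
      FSat M (interpR R) (Function.update (fun x => a (σ x)) p.1 (a j)) p.2 := by
  obtain ⟨B, hB⟩ := (fv_finite p.2).bddAbove
  obtain ⟨i, hi, rfl⟩ := List.getElem_of_mem hp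
  set l := (List.range (B + 1)).map σ with hl
  set r := (Finset.range (B + 1)).sup σ + 1 with hr
  have hget : ∀ x ≤ B, l.getD x 0 = σ x := fun x hx => by
    simp [hl, List.getD_eq_getElem?_getD, show x < B + 1 by omega]
  have hlt : ∀ x, l.getD x 0 < r := fun x => by
    by_cases hx : x ≤ B
    · rw [hget x hx]
      exact Nat.lt_succ_of_le (Finset.le_sup (Finset.mem_range.2 (by omega)))
    · rw [List.getD_eq_default _ _ (by simp [hl]; omega)]
      omega
  set j := Nat.pair (Encodable.encode (b, i, l)) r with hj
  have htask : task j = (b, i, l) := by simp [task, hj]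
  refine ⟨j, by rw [htask], fun M _ R a ha => ?_⟩
  have hcongr : ∀ m, FSat M (interpR R) (Function.update (fun x => a (σ x)) L[i].1 m) L[i].2 ↔
      FSat M (interpR R) (Function.update (fun x => a (l.getD x 0)) L[i].1 m) L[i].2 := by
    intro m
    refine FSat_congr _ _ _ _ fun x hx => ?_
    by_cases hxv : x = L[i].1
    · simp [hxv]
    · simp only [Function.update_of_ne hxv, hget x (hB hx)]
  have hgetL : L.getD i (0, .top) = L[i] := List.getD_eq_getElem _ _ hi
  rintro ⟨m, hm⟩
  rw [hcongr] at hm ⊢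
  rw [ha]
  simp only [pick, htask, hgetL]
  exact (Classical.epsilon_spec (p := fun m => (∀ x, l.getD x 0 < j) ∧ FSat M (interpR R)
    (Function.update (fun x => a (l.getD x 0)) L[i].1 m) L[i].2)
    ⟨m, fun x => (hlt x).trans_le (Nat.right_le_pair _ _), hm⟩).2

theorem FSat_limit_pick (b : Bool) (U : Ultrafilter ℕ) (M : ℕ → Type) [∀ n, Nonempty (M n)]
    (R : ∀ n, Set (Fin k → M n)) (a : ∀ n, ℕ → M n) {Q : Type} (π : ℕ → Q)
    (hsurj : Function.Surjective π) (hπ : ∀ i j, π i = π j ↔ ∀ᶠ n in (U : Filter ℕ), a n i = a n j)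
    (R₀ : Set (Fin k → Q))
    (hR₀ : ∀ w : Fin k → ℕ, (fun l => π (w l)) ∈ R₀ ↔
      ∀ᶠ n in (U : Filter ℕ), (fun l => a n (w l)) ∈ R n)
    (L : List (ℕ × FOF (SigR k)))
    (ha : ∀ j, (task j).1 = b → ∀ᶠ n in (U : Filter ℕ), a n j = pick (R n) L j (a n))
    (φ : FOF (SigR k)) (hL : ∀ p ∈ witnessPairs φ, p ∈ L) (hφ : IsSentence φ) :
    FOTrue Q (interpR R₀) φ ↔ ∀ᶠ n in (U : Filter ℕ), FOTrue (M n) (interpR (R n)) φ := by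
  rw [FOTrue_iff_of_isSentence _ hφ fun x => π x]
  simp only [fun n => FOTrue_iff_of_isSentence (interpR (R n)) hφ (a n)]
  refine FSat_limit U M R a π hsurj hπ R₀ hR₀ φ (fun p hp σ hex => ?_) id
  obtain ⟨j, hj, hspec⟩ := exists_pick_spec b L p (hL p hp) σ
  refine ⟨j, ?_⟩
  filter_upwards [hex, ha j hj] with n h1 h2
  exact hspec _ _ _ h2 h1

theorem exists_not_game {D : DepPred k} (hdc : DownwardsClosed D) (hfo : FirstOrderDep D) :
    ∃ n, ∀ M N : Type, Nontrivial M → Nontrivial N → ∀ (R : Set (Fin k → M))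
      (R' : Set (Fin k → N)) (s : ℕ → M) (s' : ℕ → N), Game R R' n 0 s s' → D N R' → D M R := by
  obtain ⟨ψ, hψ, hD⟩ := hfo
  by_contra! hcon
  choose M N hM hN R R' s s' hg hDR' hDR using hcon
  let nt : FOF (SigR k) := .ex 0 (.ex 1 (.neq 0 1))
  have hnt : IsSentence nt := by
    ext x
    simp only [nt, fv, Set.mem_sdiff, Set.mem_insert_iff, Set.mem_singleton_iff,
      Set.mem_empty_iff_false, iff_false]
    omega
  have hnt_iff : ∀ (Q : Type) [Nonempty Q] (R : Set (Fin k → Q)),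
      FOTrue Q (interpR R) nt ↔ Nontrivial Q := by
    intro Q _ R
    rw [FOTrue_iff_of_isSentence _ hnt fun _ => Classical.arbitrary Q, nontrivial_iff]
    simp [nt, FSat]
  set L := witnessPairs ψ ++ witnessPairs nt with hLdef
  have : ∀ n, Nonempty (M n) := fun n => (hM n).to_nonempty
  have : ∀ n, Nonempty (N n) := fun n => (hN n).to_nonempty
  have hplay := fun n => Game.play (fun j => (task j).1) (pick (R n) L) (pick (R' n) L)
    (pick_congr _ _) (pick_congr _ _) n 0 (s n) (s' n) (hg n)
  choose a b _ hle htask using hplay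
  let U : Ultrafilter ℕ := Filter.hyperfilter ℕ
  have hlarge : ∀ B : ℕ, ∀ᶠ n in (U : Filter ℕ), B < n := fun B =>
    Filter.hyperfilter_le_cofinite (Nat.cofinite_eq_atTop ▸ Filter.eventually_gt_atTop B)
  have hab : ∀ i j, (∀ᶠ n in (U : Filter ℕ), a n i = a n j) ↔
      ∀ᶠ n in (U : Filter ℕ), b n i = b n j := fun i j => by
    refine Filter.eventually_congr ?_
    filter_upwards [hlarge i, hlarge j] with n hi hj
    exact (hle n).1 i (by omega) j (by omega)
  let setoid : Setoid ℕ := ⟨fun i j => ∀ᶠ n in (U : Filter ℕ), a n i = a n j,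
    fun i => .of_forall fun _ => rfl, fun h => h.mono fun _ => Eq.symm,
    fun h h' => (h.and h').mono fun _ h => h.1.trans h.2⟩
  let π : ℕ → Quotient setoid := Quotient.mk setoid
  have hsurj : Function.Surjective π := Quotient.mk_surjective
  have hπa : ∀ i j, π i = π j ↔ ∀ᶠ n in (U : Filter ℕ), a n i = a n j := fun i j => Quotient.eq
  have hπb : ∀ i j, π i = π j ↔ ∀ᶠ n in (U : Filter ℕ), b n i = b n j := fun i j =>
    (hπa i j).trans (hab i j)
  let lim : ∀ {X : ℕ → Type} (_ : ∀ n, ℕ → X n) (_ : ∀ n, Set (Fin k → X n)),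
      Set (Fin k → Quotient setoid) := fun c T =>
    {q | ∀ᶠ n in (U : Filter ℕ), (fun l => c n (q l).out) ∈ T n}
  have hlim : ∀ {X : ℕ → Type} (c : ∀ n, ℕ → X n) (T : ∀ n, Set (Fin k → X n)),
      (∀ i j, π i = π j ↔ ∀ᶠ n in (U : Filter ℕ), c n i = c n j) → ∀ w : Fin k → ℕ,
      ((fun l => π (w l)) ∈ lim c T ↔ ∀ᶠ n in (U : Filter ℕ), (fun l => c n (w l)) ∈ T n) := by
    intro X c T hc w
    refine Filter.eventually_congr ?_
    have : ∀ᶠ n in (U : Filter ℕ), ∀ l, c n (π (w l)).out = c n (w l) :=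
      Filter.eventually_all.2 fun l => (hc _ _).1 (Quotient.out_eq _)
    filter_upwards [this] with n hn
    simp only [hn]
  have hmono : lim a R ⊆ lim b R' := by
    intro q hq
    have : ∀ᶠ n in (U : Filter ℕ), ∀ l, (q l).out < n :=
      Filter.eventually_all.2 fun l => hlarge _
    filter_upwards [this, hq] with n hn hR
    exact (hle n).2 _ (fun l => by simpa using hn l) hR
  have hpick : ∀ j, ∀ᶠ n in (U : Filter ℕ), ((task j).1 = true → a n j = pick (R n) L j (a n)) ∧
      ((task j).1 = false → b n j = pick (R' n) L j (b n)) := fun j => by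
    filter_upwards [hlarge j] with n hn
    exact htask n j (Nat.zero_le _) (by omega)
  have la := FSat_limit_pick true U M R a π hsurj hπa (lim a R) (hlim a R hπa) L
    fun j hj => (hpick j).mono fun n hn => hn.1 hj
  have lb := FSat_limit_pick false U N R' b π hsurj hπb (lim b R') (hlim b R' hπb) L
    fun j hj => (hpick j).mono fun n hn => hn.2 hj
  have hQ : Nontrivial (Quotient setoid) := by
    have : Nonempty (Quotient setoid) := ⟨π 0⟩
    rw [← hnt_iff _ (lim a R), la nt (fun p hp => List.mem_append_right _ hp) hnt]
    exact .of_forall fun n => (hnt_iff _ _).2 (hM n)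
  have hLψ : ∀ p ∈ witnessPairs ψ, p ∈ L := fun p hp => List.mem_append_left _ hp
  have hb : D (Quotient setoid) (lim b R') := by
    rw [hD _ hQ, lb ψ hLψ hψ]
    exact .of_forall fun n => (hD _ (hN n) _).1 (hDR' n)
  have ha := hdc _ _ _ hb hmono
  rw [hD _ hQ, la ψ hLψ hψ] at ha
  obtain ⟨n, hn⟩ := ha.exists
  exact hDR n ((hD _ (hM n) _).2 hn)

open Classical in
/-- The complement of a downwards closed first-order dependency is definable by a formula in
which the relation occurs only positively. -/
theorem compl_positive {D : DepPred k} (hdc : DownwardsClosed D) (hfo : FirstOrderDep D) :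
    ∃ χ : Pred Sig0 Unit (fun _ => k), PD Set.univ χ ∧
      ∀ M : Type, Nontrivial M → ∀ (R : Set (Fin k → M)) (s : ℕ → M),
        χ M (eI M) (fun _ => R) s ↔ ¬ D M R := by
  obtain ⟨n, hn⟩ := exists_not_game hdc hfo
  let typ : ∀ (M : Type) (R : Set (Fin k → M)) (s : ℕ → M), List (Pred Sig0 Unit fun _ => k) :=
    fun M R s => (posList k n 0).filter fun P => P M (eI M) (fun _ => R) s
  let Ts := (posList k n 0).sublists.filter fun T => ∃ (M : Type) (_ : Nontrivial M)
    (R : Set (Fin k → M)) (s : ℕ → M), ¬ D M R ∧ T = typ M R s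
  refine ⟨fun M I E s => ∃ P ∈ Ts.map fun T => (fun M I E s => ∀ P ∈ T, P M I E s :
      Pred Sig0 Unit fun _ => k), P M I E s,
    PD.any_list _ fun P hP => ?_, fun M hM R s => ⟨?_, fun h => ?_⟩⟩
  · obtain ⟨T, hT, rfl⟩ := List.mem_map.1 hP
    have hT := List.mem_sublists.1 (List.mem_filter.1 hT).1
    exact PD.all_list T fun P hP => posList_pd n 0 P (hT.subset hP)
  · rintro ⟨P, hP, hPs⟩ hDR
    obtain ⟨T, hT, rfl⟩ := List.mem_map.1 hP
    obtain ⟨N, hN, R', s', hDR', rfl⟩ := of_decide_eq_true (List.mem_filter.1 hT).2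
    refine hDR' (hn N M hN hM R' R s' s (game_of_posList n 0 _ _ fun P hP hPs' => ?_) hDR)
    exact hPs P (List.mem_filter.2 ⟨hP, by simpa using hPs'⟩)
  · refine ⟨_, List.mem_map.2 ⟨typ M R s, List.mem_filter.2
      ⟨List.mem_sublists.2 List.filter_sublist, ?_⟩, rfl⟩, fun P hP => ?_⟩
    · exact decide_eq_true ⟨M, hM, R, s, h, rfl⟩
    · simpa using (List.mem_filter.1 hP).2

end Lyndon

/-- Uniform predicates on assignments, depending on a structure. -/
abbrev Guard (S : Signature) := ∀ M : Type, Interp S M → (ℕ → M) → Prop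

section Flat

variable {S : Signature} {ι : Type} {ar : ι → ℕ}

/-- The predicate is expressed by a flat `FO(𝒟)` formula in the first `n` variables. -/
def FlatDef (ar : ι → ℕ) (n : ℕ) (P : Guard S) : Prop :=
  (∃ φ : TS S ι ar, Plain φ ∧ (∀ x ∈ fv φ, x < n) ∧
    ∀ M I A X, TSat M I A φ X ↔ ∀ s ∈ X, P M I s) ∧
  ∀ M I (s s' : ℕ → M), (∀ x < n, s x = s' x) → (P M I s ↔ P M I s')

theorem plain_and {φ ψ : TS S ι ar} (h1 : Plain φ) (h2 : Plain ψ) : Plain (.and φ ψ) :=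
  ⟨⟨h1.1, h2.1⟩, h1.2, h2.2⟩

theorem plain_or {φ ψ : TS S ι ar} (h1 : Plain φ) (h2 : Plain ψ) : Plain (.or φ ψ) :=
  ⟨⟨h1.1, h2.1⟩, h1.2, h2.2⟩

namespace FlatDef

variable {n : ℕ} {P Q : Guard S}

theorem rel {k : ℕ} (r : S k) (v : Fin k → ℕ) (hv : ∀ i, v i < n) :
    FlatDef ar n (fun _ I s => (fun i => s (v i)) ∈ I _ r) :=
  ⟨⟨.rel r v, ⟨trivial, trivial⟩, by rintro _ ⟨i, rfl⟩; exact hv i, fun _ _ _ _ => Iff.rfl⟩,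
    fun M I s s' h => by simp only [h _ (hv _)]⟩

theorem nrel {k : ℕ} (r : S k) (v : Fin k → ℕ) (hv : ∀ i, v i < n) :
    FlatDef ar n (fun _ I s => (fun i => s (v i)) ∉ I _ r) :=
  ⟨⟨.nrel r v, ⟨trivial, trivial⟩, by rintro _ ⟨i, rfl⟩; exact hv i, fun _ _ _ _ => Iff.rfl⟩,
    fun M I s s' h => by simp only [h _ (hv _)]⟩

theorem eq (x y : ℕ) (hx : x < n) (hy : y < n) :
    FlatDef (S := S) ar n (fun _ _ s => s x = s y) :=
  ⟨⟨.eq x y, ⟨trivial, trivial⟩, by rintro _ (rfl | rfl) <;> assumption,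
    fun _ _ _ _ => Iff.rfl⟩, fun M I s s' h => by simp only [h _ hx, h _ hy]⟩

theorem neq (x y : ℕ) (hx : x < n) (hy : y < n) :
    FlatDef (S := S) ar n (fun _ _ s => s x ≠ s y) :=
  ⟨⟨.neq x y, ⟨trivial, trivial⟩, by rintro _ (rfl | rfl) <;> assumption,
    fun _ _ _ _ => Iff.rfl⟩, fun M I s s' h => by simp only [h _ hx, h _ hy]⟩

theorem and (hP : FlatDef ar n P) (hQ : FlatDef ar n Q) :
    FlatDef ar n (fun M I s => P M I s ∧ Q M I s) := by
  obtain ⟨⟨φ, h1, h2, h3⟩, h4⟩ := hP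
  obtain ⟨⟨ψ, g1, g2, g3⟩, g4⟩ := hQ
  refine ⟨⟨.and φ ψ, plain_and h1 g1, fun x hx => hx.elim (h2 x) (g2 x), fun M I A X => ?_⟩,
    fun M I s s' h => and_congr (h4 M I s s' h) (g4 M I s s' h)⟩
  simp only [TSat, h3, g3]
  exact ⟨fun h s hs => ⟨h.1 s hs, h.2 s hs⟩, fun h => ⟨fun s hs => (h s hs).1,
    fun s hs => (h s hs).2⟩⟩

theorem or (hP : FlatDef ar n P) (hQ : FlatDef ar n Q) :
    FlatDef ar n (fun M I s => P M I s ∨ Q M I s) := by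
  obtain ⟨⟨φ, h1, h2, h3⟩, h4⟩ := hP
  obtain ⟨⟨ψ, g1, g2, g3⟩, g4⟩ := hQ
  refine ⟨⟨.or φ ψ, plain_or h1 g1, fun x hx => hx.elim (h2 x) (g2 x), fun M I A X => ?_⟩,
    fun M I s s' h => or_congr (h4 M I s s' h) (g4 M I s s' h)⟩
  simp only [TSat, h3, g3]
  constructor
  · rintro ⟨Y, Z, rfl, hY, hZ⟩ s (hs | hs)
    · exact .inl (hY s hs)
    · exact .inr (hZ s hs)
  · intro h
    refine ⟨{s ∈ X | P M I s}, {s ∈ X | Q M I s}, ?_, fun s hs => hs.2, fun s hs => hs.2⟩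
    ext s
    exact ⟨fun hs => hs.elim And.left And.left, fun hs => (h s hs).imp (⟨hs, ·⟩) (⟨hs, ·⟩)⟩

theorem congr (hP : FlatDef ar n P) (h : ∀ M I s, P M I s ↔ Q M I s) : FlatDef ar n Q := by
  have : P = Q := by
    funext M I s
    exact propext (h M I s)
  exact this ▸ hP

theorem mono (hP : FlatDef ar n P) {m : ℕ} (hnm : n ≤ m) : FlatDef ar m P := by
  obtain ⟨⟨φ, h1, h2, h3⟩, h4⟩ := hP
  exact ⟨⟨φ, h1, fun x hx => (h2 x hx).trans_le hnm, h3⟩,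
    fun M I s s' h => h4 M I s s' fun x hx => h x (hx.trans_le hnm)⟩

theorem true_flatDef (hn : 0 < n) : FlatDef (S := S) ar n (fun _ _ _ => True) :=
  (eq 0 0 hn hn).congr fun _ _ _ => by simp

theorem false_flatDef (hn : 0 < n) : FlatDef (S := S) ar n (fun _ _ _ => False) :=
  (neq 0 0 hn hn).congr fun _ _ _ => by simp

theorem all_list {α : Type*} (hn : 0 < n) (T : List α) (P : α → Guard S)
    (h : ∀ c ∈ T, FlatDef ar n (P c)) : FlatDef ar n (fun M I s => ∀ c ∈ T, P c M I s) := by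
  induction T with
  | nil => exact (true_flatDef hn).congr fun _ _ _ => by simp
  | cons c T ih =>
    simp only [List.mem_cons, forall_eq_or_imp] at h ⊢
    exact h.1.and (ih h.2)

theorem any_list {α : Type*} (hn : 0 < n) (T : List α) (P : α → Guard S)
    (h : ∀ c ∈ T, FlatDef ar n (P c)) : FlatDef ar n (fun M I s => ∃ c ∈ T, P c M I s) := by
  induction T with
  | nil => exact (false_flatDef hn).congr fun _ _ _ => by simp
  | cons c T ih =>
    simp only [List.mem_cons, forall_eq_or_imp, exists_eq_or_imp] at h ⊢
    exact h.1.or (ih h.2)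

end FlatDef

end Flat

section Prefix

/-- A block of quantifiers over the consecutive variables `N, N + 1, …`; `true` stands for `∃`
and `false` for `∀`. -/
def Qs {M : Type} : List Bool → ℕ → ((ℕ → M) → Prop) → (ℕ → M) → Prop
  | [], _, F, s => F s
  | true :: p, N, F, s => ∃ m, Qs p (N + 1) F (Function.update s N m)
  | false :: p, N, F, s => ∀ m, Qs p (N + 1) F (Function.update s N m)

/-- The formula obtained by prefixing a block of quantifiers over the consecutive variables
`N, N + 1, …`. -/
def prefixF {S : Signature} {ι : Type} {ar : ι → ℕ} : List Bool → ℕ → TS S ι ar → TS S ι ar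
  | [], _, φ => φ
  | true :: p, N, φ => .ex N (prefixF p (N + 1) φ)
  | false :: p, N, φ => .al N (prefixF p (N + 1) φ)

variable {M : Type}

theorem Qs_append (p q : List Bool) : ∀ (N : ℕ) (F : (ℕ → M) → Prop) (s : ℕ → M),
    Qs (p ++ q) N F s ↔ Qs p N (Qs q (N + p.length) F) s := by
  induction p with
  | nil => exact fun N F s => Iff.rfl
  | cons b p ih =>
    intro N F s
    have : N + (b :: p).length = N + 1 + p.length := by simp; omega
    rw [this]
    cases b with
    | true => exact exists_congr fun m => ih _ _ _
    | false => exact forall_congr' fun m => ih _ _ _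

theorem update_agree {N : ℕ} {s s' : ℕ → M} {m : M}
    (h : ∀ x < N + 1, s' x = Function.update s N m x) : ∀ x < N, s' x = s x := fun x hx => by
  rw [h x (by omega), Function.update_of_ne hx.ne]

theorem Qs_and [Nonempty M] (c : Prop) {F G : (ℕ → M) → Prop} (p : List Bool) :
    ∀ (N : ℕ) (s : ℕ → M), (∀ s', (∀ x < N, s' x = s x) → (F s' ↔ c ∧ G s')) →
      (Qs p N F s ↔ c ∧ Qs p N G s) := by
  induction p with
  | nil => exact fun N s h => h s fun _ _ => rfl
  | cons b p ih =>
    intro N s h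
    have ih := fun m => ih (N + 1) (Function.update s N m) fun s' hs' => h s' (update_agree hs')
    cases b with
    | true => exact (exists_congr ih).trans exists_and_left
    | false => exact (forall_congr' ih).trans (forall_and_left _ _)

theorem Qs_congr {F G : (ℕ → M) → Prop} (p : List Bool) (N : ℕ) (s : ℕ → M)
    (h : ∀ s', (∀ x < N, s' x = s x) → (F s' ↔ G s')) : Qs p N F s ↔ Qs p N G s := by
  induction p generalizing N s with
  | nil => exact h s fun _ _ => rfl
  | cons b p ih =>
    have ih := fun m => ih (N + 1) (Function.update s N m) fun s' hs' => h s' (update_agree hs')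
    cases b with
    | true => exact exists_congr ih
    | false => exact forall_congr' ih

theorem Qs_or [Nonempty M] (c : Prop) {F G : (ℕ → M) → Prop} (p : List Bool) :
    ∀ (N : ℕ) (s : ℕ → M), (∀ s', (∀ x < N, s' x = s x) → (F s' ↔ c ∨ G s')) →
      (Qs p N F s ↔ c ∨ Qs p N G s) := by
  induction p with
  | nil => exact fun N s h => h s fun _ _ => rfl
  | cons b p ih =>
    intro N s h
    have ih := fun m => ih (N + 1) (Function.update s N m) fun s' hs' => h s' (update_agree hs')
    cases b with
    | true =>
      refine (exists_congr ih).trans ?_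
      rw [exists_or, exists_const]
      rfl
    | false => exact (forall_congr' ih).trans forall_or_left

variable {S : Signature} {ι : Type} {ar : ι → ℕ}

theorem plain_prefixF {φ : TS S ι ar} (h : Plain φ) (p : List Bool) (N : ℕ) :
    Plain (prefixF p N φ) := by
  induction p generalizing N with
  | nil => exact h
  | cons b p ih => cases b <;> exact ⟨(ih (N + 1)).1, (ih (N + 1)).2⟩

theorem fv_prefixF {φ : TS S ι ar} (p : List Bool) (N : ℕ)
    (h : ∀ x ∈ fv φ, x < N + p.length) : ∀ x ∈ fv (prefixF p N φ), x < N := by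
  induction p generalizing N with
  | nil => exact h
  | cons b p ih =>
    have ih := ih (N + 1) fun x hx => by
      have := h x hx
      simp only [List.length_cons] at this
      omega
    have key : ∀ x ∈ fv (prefixF p (N + 1) φ) \ {N}, x < N := by
      rintro x ⟨hx, hxN⟩
      have := ih x hx
      simp only [Set.mem_singleton_iff] at hxN
      omega
    cases b <;> exact key

theorem TSat_prefixF {T : Type} (𝒢 : T → Prop) (Pm : T → (ℕ → M) → Prop) {I : Interp S M}
    {A : ∀ i, Set (Fin (ar i) → M) → Prop} {φ : TS S ι ar}
    (h : ∀ X, TSat M I A φ X ↔ ∃ E, 𝒢 E ∧ ∀ s ∈ X, Pm E s) (p : List Bool) (N : ℕ) :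
    ∀ X, TSat M I A (prefixF p N φ) X ↔ ∃ E, 𝒢 E ∧ ∀ s ∈ X, Qs p N (Pm E) s := by
  induction p generalizing N with
  | nil => exact h
  | cons b p ih =>
    intro X
    cases b with
    | true =>
      simp only [prefixF, TSat, ih]
      constructor
      · rintro ⟨H, hH, E, hE, h⟩
        refine ⟨E, hE, fun s hs => ?_⟩
        obtain ⟨m, hm⟩ := hH s hs
        exact ⟨m, h _ ⟨s, hs, m, hm, rfl⟩⟩
      · rintro ⟨E, hE, h⟩
        refine ⟨fun s => {m | Qs p (N + 1) (Pm E) (Function.update s N m)}, h, E, hE, ?_⟩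
        rintro _ ⟨s, hs, m, hm, rfl⟩
        exact hm
    | false =>
      simp only [prefixF, TSat, ih]
      refine exists_congr fun E => and_congr_right fun _ => ?_
      constructor
      · exact fun h s hs m => h _ ⟨s, hs, m, rfl⟩
      · rintro h _ ⟨s, hs, m, rfl⟩
        exact h s hs m

theorem TSat_alBlock {I : Interp S M} {A : ∀ i, Set (Fin (ar i) → M) → Prop} {φ : TS S ι ar}
    (k N : ℕ) (X : Set (ℕ → M)) :
    TSat M I A (prefixF (List.replicate k false) N φ) X ↔
      TSat M I A φ {s' | ∃ s ∈ X, ∀ x, (x < N ∨ N + k ≤ x) → s' x = s x} := by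
  induction k generalizing N X with
  | zero =>
    have : {s' | ∃ s ∈ X, ∀ x, (x < N ∨ N + 0 ≤ x) → s' x = s x} = X := by
      ext s'
      constructor
      · rintro ⟨s, hs, h⟩
        rwa [show s' = s from funext fun x => h x (lt_or_ge x N)]
      · exact fun h => ⟨s', h, fun _ _ => rfl⟩
    rw [this]
    rfl
  | succ k ih =>
    simp only [List.replicate_succ, prefixF, TSat, ih]
    congr! 1
    ext s'
    constructor
    · rintro ⟨_, ⟨s, hs, m, rfl⟩, h⟩
      refine ⟨s, hs, fun x hx => ?_⟩
      rw [h x (by omega), Function.update_of_ne (by omega)]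
    · rintro ⟨s, hs, h⟩
      refine ⟨_, ⟨s, hs, s' N, rfl⟩, fun x hx => ?_⟩
      by_cases hxN : x = N
      · simp [hxN]
      · rw [Function.update_of_ne hxN, h x (by omega)]

end Prefix

section NormalForm

variable {S : Signature} {σ : Type} {ak : σ → ℕ} {ι : Type} {ar : ι → ℕ}

/-- The conjunction of `β` with the clauses `γ ∨ E_x(v)` for `(γ, v) ∈ C x`. -/
def ClauseMatrix.eval (β : Guard S) (C : ∀ x : σ, List (Guard S × (Fin (ak x) → ℕ))) : Pred S σ ak :=
  fun M I E s => β M I s ∧ ∀ x, ∀ c ∈ C x, c.1 M I s ∨ (fun l => s (c.2 l)) ∈ E x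

/-- The parts of the matrix are flat and use only the first `n` variables, and only relations
from `Λ` occur in it. -/
structure ClauseMatrix.IsFlat (ar : ι → ℕ) (Λ : Set σ) (n : ℕ) (β : Guard S)
    (C : ∀ x : σ, List (Guard S × (Fin (ak x) → ℕ))) : Prop where
  base : FlatDef ar n β
  guard : ∀ x, ∀ c ∈ C x, FlatDef ar n c.1
  lt : ∀ x, ∀ c ∈ C x, ∀ l, c.2 l < n
  support : ∀ x, x ∉ Λ → C x = []

namespace ClauseMatrix

variable {Λ : Set σ} {n : ℕ} {β β₁ β₂ : Guard S}
  {C C₁ C₂ : ∀ x : σ, List (Guard S × (Fin (ak x) → ℕ))}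

theorem IsFlat.mono (h : IsFlat ar Λ n β C) {m : ℕ} (hnm : n ≤ m) : IsFlat ar Λ m β C :=
  ⟨h.base.mono hnm, fun x c hc => (h.guard x c hc).mono hnm,
    fun x c hc l => (h.lt x c hc l).trans_le hnm, h.support⟩

theorem IsFlat.and (h₁ : IsFlat ar Λ n β₁ C₁) (h₂ : IsFlat ar Λ n β₂ C₂) :
    IsFlat ar Λ n (fun M I s => β₁ M I s ∧ β₂ M I s) (fun x => C₁ x ++ C₂ x) := by
  refine ⟨h₁.base.and h₂.base, fun x c hc => ?_, fun x c hc => ?_, fun x hx => ?_⟩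
  · exact (List.mem_append.1 hc).elim (h₁.guard x c) (h₂.guard x c)
  · exact (List.mem_append.1 hc).elim (h₁.lt x c) (h₂.lt x c)
  · simp [h₁.support x hx, h₂.support x hx]

theorem eval_and (M : Type) (I : Interp S M) (E : ∀ x : σ, Set (Fin (ak x) → M)) (s : ℕ → M) :
    eval (fun M I s => β₁ M I s ∧ β₂ M I s) (fun x => C₁ x ++ C₂ x) M I E s ↔
      eval β₁ C₁ M I E s ∧ eval β₂ C₂ M I E s := by
  simp only [eval, List.mem_append]
  constructor
  · exact fun h => ⟨⟨h.1.1, fun x c hc => h.2 x c (.inl hc)⟩, h.1.2,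
      fun x c hc => h.2 x c (.inr hc)⟩
  · exact fun h => ⟨⟨h.1.1, h.2.1⟩, fun x c hc => hc.elim (h.1.2 x c) (h.2.2 x c)⟩

/-- Add an alternative to all the parts of a matrix. -/
def guarded (γ : Guard S) (C : ∀ x : σ, List (Guard S × (Fin (ak x) → ℕ))) :
    ∀ x : σ, List (Guard S × (Fin (ak x) → ℕ)) :=
  fun x => (C x).map fun c => (fun M I s => γ M I s ∨ c.1 M I s, c.2)

theorem IsFlat.guarded {γ : Guard S} (h : IsFlat ar Λ n β C) (hγ : FlatDef ar n γ) :
    IsFlat ar Λ n (fun M I s => γ M I s ∨ β M I s) (guarded γ C) := by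
  refine ⟨hγ.or h.base, fun x c hc => ?_, fun x c hc => ?_, fun x hx => ?_⟩
  · obtain ⟨c, hc', rfl⟩ := List.mem_map.1 hc
    exact hγ.or (h.guard x c hc')
  · obtain ⟨c, hc', rfl⟩ := List.mem_map.1 hc
    exact h.lt x c hc'
  · simp [ClauseMatrix.guarded, h.support x hx]

theorem eval_guarded (γ : Guard S) (M : Type) (I : Interp S M)
    (E : ∀ x : σ, Set (Fin (ak x) → M)) (s : ℕ → M) :
    eval (fun M I s => γ M I s ∨ β M I s) (guarded γ C) M I E s ↔
      γ M I s ∨ eval β C M I E s := by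
  simp only [eval, guarded, List.mem_map, forall_exists_index, and_imp,
    forall_apply_eq_imp_iff₂]
  by_cases hγ : γ M I s <;> simp [hγ]

theorem IsFlat.eval_congr (h : IsFlat ar Λ n β C) {M : Type} (I : Interp S M)
    (E : ∀ x : σ, Set (Fin (ak x) → M)) {s s' : ℕ → M} (hs : ∀ x < n, s x = s' x) :
    eval β C M I E s ↔ eval β C M I E s' := by
  refine and_congr (h.base.2 M I s s' hs) (forall_congr' fun x => forall₂_congr fun c hc => ?_)
  refine or_congr ((h.guard x c hc).2 M I s s' hs) ?_
  simp only [fun l => hs _ (h.lt x c hc l)]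

end ClauseMatrix

open ClauseMatrix

theorem exists_or_flags {M : Type} [Nontrivial M] {N : ℕ} {s : ℕ → M} {a b : Prop}
    {F G : (ℕ → M) → Prop} (hF : ∀ s', (∀ x < N, s' x = s x) → (F s' ↔ a))
    (hG : ∀ s', (∀ x < N, s' x = s x) → (G s' ↔ b)) :
    Qs [true, true] N (fun s => (s N = s (N + 1) ∨ F s) ∧ (s N ≠ s (N + 1) ∨ G s)) s ↔
      a ∨ b := by
  have hs : ∀ m m', ∀ x < N, Function.update (Function.update s N m) (N + 1) m' x = s x := by
    intro m m' x hx
    rw [Function.update_of_ne (by omega), Function.update_of_ne (by omega)]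
  simp only [Qs, hF _ (hs _ _), hG _ (hs _ _), Function.update_self,
    Function.update_of_ne (show N ≠ N + 1 by omega)]
  constructor
  · rintro ⟨m, m', h1, h2⟩
    by_cases h : m = m'
    · exact .inr (h2.resolve_left fun hne => hne h)
    · exact .inl (h1.resolve_left h)
  · obtain ⟨m, m', hne⟩ := exists_pair_ne M
    rintro (h | h)
    · exact ⟨m, m', .inr h, .inl hne⟩
    · exact ⟨m, m, .inl rfl, .inr h⟩

open Classical in
theorem PD.normal_form {Λ : Set σ} {P : Pred S σ ak} (h : PD Λ P) (ar : ι → ℕ) :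
    ∀ (N : ℕ) (e : ℕ → ℕ), (∀ x, e x < N) →
      ∃ (p : List Bool) (β : Guard S) (C : ∀ x : σ, List (Guard S × (Fin (ak x) → ℕ))),
        IsFlat ar Λ (N + p.length) β C ∧ ∀ M : Type, Nontrivial M → ∀ I E (s : ℕ → M),
          P M I E (fun n => s (e n)) ↔ Qs p N (eval β C M I E) s := by
  have flat : ∀ {N : ℕ} {β : Guard S}, FlatDef ar N β → ∃ (p : List Bool) (β' : Guard S)
      (C : ∀ x : σ, List (Guard S × (Fin (ak x) → ℕ))),
        IsFlat ar Λ (N + p.length) β' C ∧ ∀ M : Type, Nontrivial M → ∀ I E (s : ℕ → M),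
          β M I s ↔ Qs p N (eval β' C M I E) s := fun {N β} h =>
    ⟨[], β, fun _ => [], ⟨h, by simp, by simp, by simp⟩, fun M _ I E s => by simp [Qs, eval]⟩
  have cons_lt : ∀ {N : ℕ} {e : ℕ → ℕ}, (∀ x, e x < N) → ∀ x, cons N e x < N + 1 := by
    intro N e he x
    cases x with
    | zero => exact Nat.lt_succ_self N
    | succ x => exact (he x).trans (Nat.lt_succ_self N)
  have cons_eq : ∀ {M : Type} {N : ℕ} {e : ℕ → ℕ} (s : ℕ → M) (m : M), (∀ x, e x < N) →
      (fun n => Function.update s N m (cons N e n)) = cons m fun n => s (e n) := by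
    intro M N e s m he
    funext x
    cases x with
    | zero => simp [cons]
    | succ x => simp [cons, (he x).ne]
  induction h with
  | rel r v => exact fun N e he => flat (.rel r _ fun i => he _)
  | nrel r v => exact fun N e he => flat (.nrel r _ fun i => he _)
  | eq x y => exact fun N e he => flat (.eq _ _ (he _) (he _))
  | neq x y => exact fun N e he => flat (.neq _ _ (he _) (he _))
  | atom x hx v =>
    intro N e he
    have hN : 0 < N := (Nat.zero_le _).trans_lt (he 0)
    have hC : ∀ y (c : Guard S × (Fin (ak y) → ℕ)), c ∈ Function.update
        (β := fun y => List (Guard S × (Fin (ak y) → ℕ))) (fun _ => []) x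
        [((fun _ _ _ => False : Guard S), fun l => e (v l))] y →
        c.1 = (fun _ _ _ => False) ∧ ∀ l, c.2 l < N := by
      intro y c hc
      by_cases hyx : y = x
      · subst hyx
        simp only [Function.update_self, List.mem_singleton] at hc
        exact hc ▸ ⟨rfl, fun l => he _⟩
      · simp [Function.update_of_ne hyx] at hc
    refine ⟨[], fun _ _ _ => True, Function.update (fun _ => []) x
      [(fun _ _ _ => False, fun l => e (v l))], ⟨.true_flatDef hN, fun y c hc => ?_,
      fun y c hc => (hC y c hc).2, fun y hy => ?_⟩, fun M _ I E s => ?_⟩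
    · rw [(hC y c hc).1]
      exact .false_flatDef hN
    · exact Function.update_of_ne (by rintro rfl; exact hy hx) _ _
    · simp only [Qs, eval, true_and]
      constructor
      · intro h y c hc
        by_cases hyx : y = x
        · subst hyx
          simp only [Function.update_self, List.mem_singleton] at hc
          subst hc
          exact .inr h
        · simp [Function.update_of_ne hyx] at hc
      · intro h
        have := h x (fun _ _ _ => False, fun l => e (v l)) (by simp)
        simpa using this
  | and _ _ ih1 ih2 =>
    intro N e he
    obtain ⟨p₁, β₁, C₁, hf₁, h₁⟩ := ih1 N e he
    obtain ⟨p₂, β₂, C₂, hf₂, h₂⟩ := ih2 (N + p₁.length) e fun x => (he x).trans_le (by omega)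
    refine ⟨p₁ ++ p₂, _, _, (hf₁.mono ?_).and (hf₂.mono ?_), fun M hM I E s => ?_⟩
    · rw [List.length_append]; omega
    · rw [List.length_append]; omega
    have : Nonempty M := hM.to_nonempty
    beta_reduce
    rw [Qs_append, h₁ M hM, and_comm]
    symm
    refine Qs_and _ _ _ _ fun s' hs' => ?_
    rw [and_comm, show (fun n => s (e n)) = fun n => s' (e n) from
      funext fun n => (hs' _ (he n)).symm, h₂ M hM]
    refine Qs_and _ _ _ _ fun s'' hs'' => ?_
    rw [eval_and, hf₁.eval_congr I E hs'']
  | or _ _ ih1 ih2 =>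
    intro N e he
    obtain ⟨p₁, β₁, C₁, hf₁, h₁⟩ := ih1 N e he
    obtain ⟨p₂, β₂, C₂, hf₂, h₂⟩ := ih2 (N + p₁.length) e fun x => (he x).trans_le (by omega)
    set n := N + p₁.length + p₂.length with hn
    have hlen : N + (p₁ ++ (p₂ ++ [true, true])).length = n + 2 := by simp; omega
    have hflat := ((hf₁.mono (m := n + 2) (by omega)).guarded
      (.eq n (n + 1) (by omega) (by omega))).and
        ((hf₂.mono (by omega)).guarded (.neq n (n + 1) (by omega) (by omega)))
    rw [← hlen] at hflat
    refine ⟨p₁ ++ (p₂ ++ [true, true]), _, _, hflat, fun M hM I E s => ?_⟩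
    have : Nonempty M := hM.to_nonempty
    beta_reduce
    rw [Qs_append, h₁ M hM, or_comm]
    symm
    refine Qs_or _ _ _ _ fun s' hs' => ?_
    rw [or_comm, show (fun n => s (e n)) = fun n => s' (e n) from
      funext fun n => (hs' _ (he n)).symm, h₂ M hM, Qs_append]
    refine Qs_or _ _ _ _ fun s'' hs'' => ?_
    refine (Qs_congr _ _ _ fun t _ => (eval_and M I E t).trans (and_congr (eval_guarded _ M I E t)
      (eval_guarded _ M I E t))).trans (exists_or_flags (fun t ht => ?_) (fun t ht => ?_))
    · exact hf₁.eval_congr I E fun x hx => (ht x (by omega)).trans (hs'' x hx)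
    · exact hf₂.eval_congr I E fun x hx => ht x (by omega)
  | ex _ ih =>
    intro N e he
    obtain ⟨p, β, C, hf, h⟩ := ih (N + 1) (cons N e) (cons_lt he)
    refine ⟨true :: p, β, C, by convert hf using 1; simp; omega, fun M hM I E s => ?_⟩
    refine exists_congr fun m => ?_
    rw [← h M hM, cons_eq s m he]
  | al _ ih =>
    intro N e he
    obtain ⟨p, β, C, hf, h⟩ := ih (N + 1) (cons N e) (cons_lt he)
    refine ⟨false :: p, β, C, by convert hf using 1; simp; omega, fun M hM I E s => ?_⟩
    refine forall_congr' fun m => ?_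
    rw [← h M hM, cons_eq s m he]
  | congr _ h ih =>
    intro N e he
    obtain ⟨p, β, C, hf, h'⟩ := ih N e he
    exact ⟨p, β, C, hf, fun M hM I E s => by rw [← h M hM, h' M hM]⟩

end NormalForm

section Gather

variable {S : Signature} {ι : Type} {ar : ι → ℕ}

/-- A formula stating that some relation in `D i` satisfies the clauses `γ ∨ E(v)` for
`(γ, v)` in the list. -/
theorem exists_gather (D : ∀ i, DepPred (ar i)) (hdc : ∀ i, DownwardsClosed (D i)) (i : ι) (N : ℕ)
    (hN : 0 < N) (L : List (Guard S × (Fin (ar i) → ℕ))) (hL : ∀ c ∈ L, FlatDef ar N c.1)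
    (hlt : ∀ c ∈ L, ∀ l, c.2 l < N) :
    ∃ F : TS S ι ar, Plain F ∧ (∀ x ∈ fv F, x < N) ∧ ∀ (M : Type) I X,
      TSat M I (fun i => D i M) F X ↔
        ∃ R, D i M R ∧ ∀ s ∈ X, ∀ c ∈ L, c.1 M I s ∨ (fun l => s (c.2 l)) ∈ R := by
  obtain ⟨⟨θ, hθp, hθv, hθ⟩, -⟩ := FlatDef.all_list (n := N + ar i) (by omega) L
    (fun c M I s => c.1 M I s ∨ ∃ l ∈ List.finRange (ar i), s (N + l) ≠ s (c.2 l))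
    fun c hc => ((hL c hc).mono (by omega)).or
      (.any_list (by omega) _ _ fun l _ => .neq _ _ (by omega) (by have := hlt c hc l; omega))
  refine ⟨prefixF (List.replicate (ar i) false) N (.or θ (.dep i fun l => N + l)),
    plain_prefixF (plain_or hθp ⟨by trivial, by trivial⟩) _ _, fv_prefixF _ _ ?_, fun M I X => ?_⟩
  · rintro x (hx | ⟨l, rfl⟩)
    · simpa using hθv x hx
    · simp
  rw [TSat_alBlock]
  simp only [TSat, hθ]
  constructor
  · rintro ⟨Y, Z, hYZ, hY, hZ⟩
    refine ⟨_, hZ, fun s hs c hc => ?_⟩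
    set s' : ℕ → M := fun x => if h : N ≤ x ∧ x < N + ar i then s (c.2 ⟨x - N, by omega⟩) else s x
      with hs'def
    have hs'X : s' ∈ {s' | ∃ s ∈ X, ∀ x, (x < N ∨ N + ar i ≤ x) → s' x = s x} :=
      ⟨s, hs, fun x hx => by
        simp only [hs'def]
        rw [dif_neg (by omega)]⟩
    have hs'N : ∀ x < N, s x = s' x := fun x hx => by
      simp only [hs'def]
      rw [dif_neg (by omega)]
    have hs'l : ∀ l : Fin (ar i), s' (N + l) = s (c.2 l) := fun l => by
      simp only [hs'def]
      rw [dif_pos (by omega)]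
      congr! 3
      omega
    rw [← hYZ] at hs'X
    rcases hs'X with h | h
    · rcases hY s' h c hc with h | ⟨l, -, hl⟩
      · exact .inl (((hL c hc).2 M I s s' hs'N).2 h)
      · rw [hs'l, ← hs'N _ (hlt c hc l)] at hl
        exact absurd rfl hl
    · exact .inr ⟨s', h, funext fun l => (hs'l l).symm⟩
  · rintro ⟨R, hR, h⟩
    let X' : Set (ℕ → M) := {s' | ∃ s ∈ X, ∀ x, (x < N ∨ N + ar i ≤ x) → s' x = s x}
    refine ⟨{s ∈ X' | ∀ c ∈ L, c.1 M I s ∨ ∃ l ∈ List.finRange (ar i), s (N + l) ≠ s (c.2 l)},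
      {s ∈ X' | ¬ ∀ c ∈ L, c.1 M I s ∨ ∃ l ∈ List.finRange (ar i), s (N + l) ≠ s (c.2 l)},
      Set.ext fun s => by
        simp only [Set.mem_union, Set.mem_sep_iff, ← and_or_left, Classical.em, and_true]; rfl, fun s hs => hs.2, hdc i M R _ hR ?_⟩
    rintro _ ⟨s', ⟨⟨s, hs, hss'⟩, hs'⟩, rfl⟩
    push Not at hs'
    obtain ⟨c, hc, hcs', hl⟩ := hs'
    have hcs := ((hL c hc).2 M I s s' fun x hx => (hss' x (.inl hx)).symm).not.2 hcs'
    convert (h s hs c hc).resolve_left hcs using 2 with l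
    rw [hl l (List.mem_finRange l), hss' _ (.inl (hlt c hc l))]

open ClauseMatrix

open Classical in
/-- Existential quantification over relations in the dependencies, with positive occurrences of
these relations, is expressible in `FO(𝒟)`. -/
theorem exists_sentence_of_pd {σ : Type} (slot : σ → ι) (D : ∀ i, DepPred (ar i))
    (hdc : ∀ i, DownwardsClosed (D i)) (Λ : List σ) {P : Pred S σ fun x => ar (slot x)}
    (hP : PD {x | x ∈ Λ} P) :
    ∃ φ : TS S ι ar, IsSentence φ ∧ Plain φ ∧ ∀ (M : Type), Nontrivial M → ∀ I,
      (TTrue M I (fun i => D i M) φ ↔ ∃ E : ∀ x, Set (Fin (ar (slot x)) → M),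
        (∀ x ∈ Λ, D (slot x) M (E x)) ∧ ∀ m : M, P M I E fun _ => m) := by
  obtain ⟨p, β, C, hf, hp⟩ := PD.normal_form (.al (hP.rename fun _ => 0)) ar 1 (fun _ => 0)
    fun _ => Nat.zero_lt_one
  set N := 1 + p.length
  choose F hFp hFv hF using fun x => exists_gather D hdc (slot x) N (by omega) (C x)
    (hf.guard x) (hf.lt x)
  obtain ⟨⟨φβ, hβp, hβv, hβ⟩, -⟩ := hf.base
  have hconj : ∀ T : List σ, ∃ φ : TS S ι ar, Plain φ ∧ (∀ x ∈ fv φ, x < N) ∧ ∀ M I A X,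
      TSat M I A φ X ↔ (∀ s ∈ X, β M I s) ∧ ∀ x ∈ T, TSat M I A (F x) X := by
    intro T
    induction T with
    | nil => exact ⟨φβ, hβp, hβv, by simpa using hβ⟩
    | cons x T ih =>
      obtain ⟨φ, h1, h2, h3⟩ := ih
      refine ⟨.and (F x) φ, plain_and (hFp x) h1, fun y hy => hy.elim (hFv x y) (h2 y),
        fun M I A X => ?_⟩
      simp only [TSat, h3, List.mem_cons, forall_eq_or_imp]
      tauto
  obtain ⟨φ, hφp, hφv, hφ⟩ := hconj Λ
  have hsat : ∀ (M : Type) I X, TSat M I (fun i => D i M) φ X ↔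
      ∃ E : ∀ x, Set (Fin (ar (slot x)) → M),
        (∀ x ∈ Λ, D (slot x) M (E x)) ∧ ∀ s ∈ X, eval β C M I E s := by
    intro M I X
    simp only [hφ, hF]
    constructor
    · rintro ⟨hβ, h⟩
      choose! E hE hEX using h
      refine ⟨E, hE, fun s hs => ⟨hβ s hs, fun x c hc => ?_⟩⟩
      by_cases hx : x ∈ Λ
      · exact hEX x hx s hs c hc
      · rw [hf.support x hx] at hc
        simp at hc
    · rintro ⟨E, hE, h⟩
      exact ⟨fun s hs => (h s hs).1, fun x hx => ⟨E x, hE x hx, fun s hs => (h s hs).2 x⟩⟩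
  refine ⟨prefixF (true :: p) 0 φ, ?_, plain_prefixF hφp _ _, fun M hM I => ?_⟩
  · refine Set.eq_empty_of_forall_notMem fun x hx => ?_
    have := fv_prefixF (true :: p) 0 (fun y hy => ?_) x hx
    · omega
    · have := hφv y hy
      simp only [List.length_cons]
      omega
  · rw [TTrue, TSat_prefixF _ _ (hsat M I)]
    refine exists_congr fun E => and_congr_right fun _ => ?_
    simp only [Qs, ← hp M hM, cons, Set.mem_univ, true_imp_iff]
    have : Nonempty M := hM.to_nonempty
    exact ⟨fun h => (h fun _ => Classical.arbitrary M).elim fun _ h => h,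
      fun h _ => ⟨Classical.arbitrary M, h⟩⟩

end Gather

theorem SFOFam.firstOrderDep {ι : Type} {ar : ι → ℕ} {D : ∀ i, DepPred (ar i)} (h : SFOFam D)
    (i : ι) : FirstOrderDep (D i) := by
  let v : Fin (ar i) → ℕ := fun l => l
  let r : SigR (ar i) (ar i) := ⟨rfl⟩
  let φ : TS (SigR (ar i)) ι ar := .or (.nrel r v) (.and (.rel r v) (.dep i v))
  have hfv : ∀ x ∈ fv φ, x < 0 + (List.replicate (ar i) false).length := by
    rintro x (⟨l, rfl⟩ | ⟨l, rfl⟩ | ⟨l, rfl⟩) <;> simp [v]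
  obtain ⟨ψ, hψ, hiff⟩ := h _ (prefixF (List.replicate (ar i) false) 0 φ)
    (Set.eq_empty_of_forall_notMem fun x hx => Nat.not_lt_zero x (fv_prefixF _ _ hfv x hx))
    (plain_prefixF (φ := φ) ⟨⟨trivial, trivial, trivial⟩, trivial, trivial, trivial⟩ _ _)
  refine ⟨ψ, hψ, fun M hM R => ?_⟩
  have huniv : {s' : ℕ → M | ∃ s ∈ (Set.univ : Set (ℕ → M)), ∀ x, (x < 0 ∨ 0 + ar i ≤ x) → s' x = s x} =
      Set.univ := Set.eq_univ_of_forall fun s => ⟨s, trivial, fun _ _ => rfl⟩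
  rw [← hiff M hM, TTrue, TSat_alBlock, huniv]
  have hmem : ∀ s : ℕ → M, (fun l => s (v l)) ∈ interpR R _ r ↔ (fun l => s (v l)) ∈ R :=
    fun s => Iff.rfl
  simp only [φ, TSat, hmem]
  have : Nonempty M := hM.to_nonempty
  have hext : ∀ t : Fin (ar i) → M, ∃ s : ℕ → M, (fun l => s (v l)) = t := fun t =>
    ⟨fun x => if h : x < ar i then t ⟨x, h⟩ else Classical.arbitrary M, by simp [v]⟩
  constructor
  · intro hD
    refine ⟨{s | (fun l => s (v l)) ∉ R}, {s | (fun l => s (v l)) ∈ R},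
      Set.eq_univ_of_forall fun s => (em _).symm, fun s hs => hs, fun s hs => hs, ?_⟩
    convert hD
    ext t
    constructor
    · rintro ⟨s, hs, rfl⟩
      exact hs
    · intro ht
      obtain ⟨s, rfl⟩ := hext t
      exact ⟨s, ht, rfl⟩
  · rintro ⟨Y, Z, hYZ, hY, hZ, hD⟩
    convert hD
    ext t
    constructor
    · intro ht
      obtain ⟨s, rfl⟩ := hext t
      have hs : s ∈ Y ∪ Z := hYZ ▸ Set.mem_univ s
      exact ⟨s, hs.resolve_left fun hs => hY s hs ht, rfl⟩
    · rintro ⟨s, hs, rfl⟩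
      exact hZ s hs

section Elimination

variable {S : Signature} {ι : Type} {ar : ι → ℕ}

/-- The occurrences of atoms of `𝒟` in a formula. -/
def slots : TS S (ι ⊕ ι) (Sum.elim ar ar) → List (List Bool × ι)
  | .dep (.inl i) _ => [([], i)]
  | .and φ ψ | .or φ ψ | .gdisj φ ψ =>
    (slots φ).map (fun x => (false :: x.1, x.2)) ++ (slots ψ).map (fun x => (true :: x.1, x.2))
  | .cneg φ => slots φ
  | .ex _ φ => slots φ
  | .al _ φ => slots φ
  | _ => []

/-- A relation for every possible occurrence of an atom of `𝒟`. -/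
abbrev Env (ar : ι → ℕ) (M : Type) := ∀ x : List Bool × ι, Set (Fin (ar x.2) → M)

/-- The relations for the occurrences in the left or right immediate subformula. -/
def Env.sub {M : Type} (b : Bool) (E : Env ar M) : Env ar M := fun x => E (b :: x.1, x.2)

/-- Combine relations for the occurrences in the left and right immediate subformulas. -/
def Env.glue {M : Type} (E₁ E₂ : Env ar M) : Env ar M
  | (false :: l, i) => E₁ (l, i)
  | (true :: l, i) => E₂ (l, i)
  | ([], _) => ∅

/-- The pointwise part of the semantics of a formula: the atoms of `𝒟` are replaced by
membership in the given relations, those of `∼𝒟` are dropped. -/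
def flatSat {M : Type} (I : Interp S M) :
    TS S (ι ⊕ ι) (Sum.elim ar ar) → Env ar M → (ℕ → M) → Prop
  | .rel r v, _, s => (fun i => s (v i)) ∈ I _ r
  | .nrel r v, _, s => (fun i => s (v i)) ∉ I _ r
  | .eq x y, _, s => s x = s y
  | .neq x y, _, s => s x ≠ s y
  | .dep (.inl i) v, E, s => (fun l => s (v l)) ∈ E ([], i)
  | .dep (.inr _) _, _, _ => True
  | .and φ ψ, E, s => flatSat I φ (E.sub false) s ∧ flatSat I ψ (E.sub true) s
  | .or φ ψ, E, s => flatSat I φ (E.sub false) s ∨ flatSat I ψ (E.sub true) s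
  | .gdisj _ _, _, _ => True
  | .cneg _, _, _ => True
  | .ex v φ, E, s => ∃ m, flatSat I φ E (Function.update s v m)
  | .al v φ, E, s => ∀ m, flatSat I φ E (Function.update s v m)

/-- The upwards closed part of the semantics of a formula: the atoms of `∼𝒟` hold in the
largest teams allowed by the pointwise part. -/
def upSat {M : Type} (D : ∀ i, DepPred (ar i)) (I : Interp S M) :
    TS S (ι ⊕ ι) (Sum.elim ar ar) → Env ar M → Set (ℕ → M) → Prop
  | .dep (.inr i) v, _, X => ¬ D i M (teamProj v X)
  | .and φ ψ, E, X => upSat D I φ (E.sub false) X ∧ upSat D I ψ (E.sub true) X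
  | .or φ ψ, E, X => upSat D I φ (E.sub false) {s | s ∈ X ∧ flatSat I φ (E.sub false) s} ∧
      upSat D I ψ (E.sub true) {s | s ∈ X ∧ flatSat I ψ (E.sub true) s}
  | .ex v φ, E, X => upSat D I φ E {s | (∃ m, Function.update s v m ∈ X) ∧ flatSat I φ E s}
  | .al v φ, E, X => upSat D I φ E {s | ∃ m, Function.update s v m ∈ X}
  | _, _, _ => True

theorem upSat_mono {M : Type} {D : ∀ i, DepPred (ar i)} (hdc : ∀ i, DownwardsClosed (D i))
    (I : Interp S M) (φ : TS S (ι ⊕ ι) (Sum.elim ar ar)) : ∀ (E : Env ar M) (X Y : Set (ℕ → M)),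
      X ⊆ Y → upSat D I φ E X → upSat D I φ E Y := by
  induction φ with
  | dep i v =>
    cases i with
    | inl i => exact fun _ _ _ _ h => h
    | inr i =>
      refine fun E X Y hXY h hY => h (hdc i M _ _ hY ?_)
      rintro _ ⟨s, hs, rfl⟩
      exact ⟨s, hXY hs, rfl⟩
  | and φ ψ ih1 ih2 => exact fun E X Y hXY h => ⟨ih1 _ X Y hXY h.1, ih2 _ X Y hXY h.2⟩
  | or φ ψ ih1 ih2 =>
    exact fun E X Y hXY h => ⟨ih1 _ _ _ (fun s hs => ⟨hXY hs.1, hs.2⟩) h.1,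
      ih2 _ _ _ (fun s hs => ⟨hXY hs.1, hs.2⟩) h.2⟩
  | ex v φ ih =>
    exact fun E X Y hXY h => ih E _ _ (fun s hs => ⟨hs.1.imp fun m hm => hXY hm, hs.2⟩) h
  | al v φ ih => exact fun E X Y hXY h => ih E _ _ (fun s hs => hs.imp fun m hm => hXY hm) h
  | _ => exact fun _ _ _ _ h => h

theorem flatSat_congr {M : Type} (I : Interp S M) (φ : TS S (ι ⊕ ι) (Sum.elim ar ar)) :
    ∀ (E : Env ar M) (s s' : ℕ → M), (∀ x ∈ fv φ, s x = s' x) →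
      (flatSat I φ E s ↔ flatSat I φ E s') := by
  have quant : ∀ {φ : TS S (ι ⊕ ι) (Sum.elim ar ar)} {v : ℕ} {s s' : ℕ → M} (m : M),
      (∀ x ∈ fv φ \ {v}, s x = s' x) →
      ∀ x ∈ fv φ, Function.update s v m x = Function.update s' v m x := by
    intro φ v s s' m h x hx
    by_cases hxv : x = v
    · subst hxv; simp
    · simpa [hxv] using h x ⟨hx, hxv⟩
  induction φ with
  | rel r v =>
    intro E s s' h
    have : (fun i => s (v i)) = fun i => s' (v i) := funext fun i => h _ ⟨i, rfl⟩
    simp only [flatSat, this]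
  | nrel r v =>
    intro E s s' h
    have : (fun i => s (v i)) = fun i => s' (v i) := funext fun i => h _ ⟨i, rfl⟩
    simp only [flatSat, this]
  | eq x y =>
    intro E s s' h
    simp only [flatSat, h x (by simp [fv]), h y (by simp [fv])]
  | neq x y =>
    intro E s s' h
    simp only [flatSat, h x (by simp [fv]), h y (by simp [fv])]
  | dep i v =>
    intro E s s' h
    have : (fun l => s (v l)) = fun l => s' (v l) := funext fun l => h _ ⟨l, rfl⟩
    cases i with
    | inl i => exact iff_of_eq (congrArg (· ∈ E ([], i)) this)
    | inr i => exact Iff.rfl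
  | and φ ψ ih1 ih2 =>
    exact fun E s s' h => and_congr (ih1 _ s s' fun x hx => h x (.inl hx))
      (ih2 _ s s' fun x hx => h x (.inr hx))
  | or φ ψ ih1 ih2 =>
    exact fun E s s' h => or_congr (ih1 _ s s' fun x hx => h x (.inl hx))
      (ih2 _ s s' fun x hx => h x (.inr hx))
  | gdisj φ ψ => exact fun _ _ _ _ => Iff.rfl
  | cneg φ => exact fun _ _ _ _ => Iff.rfl
  | ex v φ ih => exact fun E s s' h => exists_congr fun m => ih E _ _ (quant m h)
  | al v φ ih => exact fun E s s' h => forall_congr' fun m => ih E _ _ (quant m h)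

/-- The relations for the occurrences in a formula belong to the respective dependencies. -/
def Env.Good {M : Type} (D : ∀ i, DepPred (ar i)) (T : List (List Bool × ι)) (E : Env ar M) :
    Prop := ∀ x ∈ T, D x.2 M (E x)

theorem Env.good_sub {M : Type} {D : ∀ i, DepPred (ar i)} {T₁ T₂ : List (List Bool × ι)}
    {E : Env ar M} (h : E.Good D (T₁.map (fun x => (false :: x.1, x.2)) ++
      T₂.map (fun x => (true :: x.1, x.2)))) :
    (E.sub false).Good D T₁ ∧ (E.sub true).Good D T₂ :=
  ⟨fun x hx => h (false :: x.1, x.2) (List.mem_append_left _ (List.mem_map.2 ⟨x, hx, rfl⟩)),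
    fun x hx => h (true :: x.1, x.2) (List.mem_append_right _ (List.mem_map.2 ⟨x, hx, rfl⟩))⟩

theorem Env.good_glue {M : Type} {D : ∀ i, DepPred (ar i)} {T₁ T₂ : List (List Bool × ι)}
    {E₁ E₂ : Env ar M} (h₁ : E₁.Good D T₁) (h₂ : E₂.Good D T₂) :
    (E₁.glue E₂).Good D (T₁.map (fun x => (false :: x.1, x.2)) ++
      T₂.map (fun x => (true :: x.1, x.2))) := by
  intro x hx
  rcases List.mem_append.1 hx with hx | hx <;> obtain ⟨y, hy, rfl⟩ := List.mem_map.1 hx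
  · exact h₁ y hy
  · exact h₂ y hy

open Classical in
theorem TSat_iff_exists_env {M : Type} {D : ∀ i, DepPred (ar i)}
    (hdc : ∀ i, DownwardsClosed (D i)) (I : Interp S M) (φ : TS S (ι ⊕ ι) (Sum.elim ar ar))
    (hφ : Plain φ) : ∀ X : Set (ℕ → M), TSat M I (fun i => withComplFam D i M) φ X ↔
      ∃ E : Env ar M, E.Good D (slots φ) ∧ (∀ s ∈ X, flatSat I φ E s) ∧ upSat D I φ E X := by
  have lit : ∀ {X : Set (ℕ → M)} {F : (ℕ → M) → Prop}, (∀ s ∈ X, F s) ↔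
      ∃ E : Env ar M, E.Good D [] ∧ (∀ s ∈ X, F s) ∧ True :=
    ⟨fun h => ⟨fun _ => ∅, by simp [Env.Good], h, trivial⟩, fun ⟨_, _, h, _⟩ => h⟩
  induction φ with
  | rel r v => exact fun X => lit
  | nrel r v => exact fun X => lit
  | eq x y => exact fun X => lit
  | neq x y => exact fun X => lit
  | dep i v =>
    intro X
    cases i with
    | inl i =>
      constructor
      · intro h
        refine ⟨Function.update (fun _ => ∅) ([], i) (teamProj v X), fun x hx => ?_,
          fun s hs => ?_, trivial⟩
        · obtain rfl : x = ([], i) := List.mem_singleton.1 hx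
          rw [Function.update_self]
          exact h
        · simp only [flatSat, Function.update_self]
          exact ⟨s, hs, rfl⟩
      · rintro ⟨E, hE, hs, -⟩
        refine hdc i M _ _ (hE ([], i) (List.mem_singleton.2 rfl)) ?_
        rintro _ ⟨s, hsX, rfl⟩
        exact hs s hsX
    | inr i =>
      exact ⟨fun h => ⟨fun _ => ∅, by simp [Env.Good, slots], fun _ _ => trivial, h⟩,
        fun ⟨_, _, _, h⟩ => h⟩
  | and φ ψ ih1 ih2 =>
    intro X
    have ih1 := ih1 ⟨hφ.1.1, hφ.2.1⟩ X
    have ih2 := ih2 ⟨hφ.1.2, hφ.2.2⟩ X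
    simp only [TSat, ih1, ih2]
    constructor
    · rintro ⟨⟨E₁, hE₁, hf₁, hu₁⟩, E₂, hE₂, hf₂, hu₂⟩
      exact ⟨E₁.glue E₂, Env.good_glue hE₁ hE₂, fun s hs => ⟨hf₁ s hs, hf₂ s hs⟩, hu₁, hu₂⟩
    · rintro ⟨E, hE, hf, hu⟩
      exact ⟨⟨_, (Env.good_sub hE).1, fun s hs => (hf s hs).1, hu.1⟩,
        _, (Env.good_sub hE).2, fun s hs => (hf s hs).2, hu.2⟩
  | or φ ψ ih1 ih2 =>
    intro X
    have ih1 := ih1 ⟨hφ.1.1, hφ.2.1⟩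
    have ih2 := ih2 ⟨hφ.1.2, hφ.2.2⟩
    simp only [TSat, ih1, ih2]
    constructor
    · rintro ⟨Y, Z, rfl, ⟨E₁, hE₁, hf₁, hu₁⟩, E₂, hE₂, hf₂, hu₂⟩
      exact ⟨E₁.glue E₂, Env.good_glue hE₁ hE₂, fun s hs => hs.imp (hf₁ s) (hf₂ s),
        upSat_mono hdc I φ E₁ _ _ (fun s hs => ⟨.inl hs, hf₁ s hs⟩) hu₁,
        upSat_mono hdc I ψ E₂ _ _ (fun s hs => ⟨.inr hs, hf₂ s hs⟩) hu₂⟩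
    · rintro ⟨E, hE, hf, hu⟩
      refine ⟨_, _, ?_, ⟨_, (Env.good_sub hE).1, fun s hs => hs.2, hu.1⟩,
        _, (Env.good_sub hE).2, fun s hs => hs.2, hu.2⟩
      ext s
      exact ⟨fun hs => hs.elim And.left And.left, fun hs => (hf s hs).imp (⟨hs, ·⟩) (⟨hs, ·⟩)⟩
  | gdisj φ ψ => exact hφ.2.elim
  | cneg φ => exact hφ.1.elim
  | ex v φ ih =>
    intro X
    simp only [TSat, ih hφ]
    constructor
    · rintro ⟨H, hH, E, hE, hf, hu⟩
      refine ⟨E, hE, fun s hs => ?_, upSat_mono hdc I φ E _ _ (fun s' hs' => ?_) hu⟩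
      · obtain ⟨m, hm⟩ := hH s hs
        exact ⟨m, hf _ ⟨s, hs, m, hm, rfl⟩⟩
      · refine ⟨?_, hf s' hs'⟩
        obtain ⟨s, hs, m, -, rfl⟩ := hs'
        exact ⟨s v, by simpa using hs⟩
    · rintro ⟨E, hE, hf, hu⟩
      refine ⟨fun s => {m | flatSat I φ E (Function.update s v m)}, hf, E, hE, ?_, ?_⟩
      · rintro _ ⟨s, hs, m, hm, rfl⟩
        exact hm
      · refine upSat_mono hdc I φ E _ _ ?_ hu
        rintro s' ⟨⟨m, hm⟩, hs'⟩
        exact ⟨_, hm, s' v, by simpa using hs', by simp⟩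
  | al v φ ih =>
    intro X
    have hX : {s' | ∃ s ∈ X, ∃ m : M, s' = Function.update s v m} =
        {s | ∃ m, Function.update s v m ∈ X} := by
      ext s'
      constructor
      · rintro ⟨s, hs, m, rfl⟩
        exact ⟨s v, by simpa using hs⟩
      · rintro ⟨m, hm⟩
        exact ⟨_, hm, s' v, by simp⟩
    simp only [TSat, ih hφ, hX]
    refine exists_congr fun E => and_congr_right fun _ => and_congr_left' ?_
    constructor
    · exact fun h s hs m => h _ ⟨s v, by simpa using hs⟩
    · rintro h s ⟨m, hm⟩
      simpa using h _ hm (s v)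

/-- Reindex the relations along a map of addresses of occurrences. -/
def Env.pull {M : Type} (g : List Bool → List Bool) (E : Env ar M) : Env ar M :=
  fun x => E (g x.1, x.2)

theorem slots_append_mem {T₁ T₂ : List (List Bool × ι)} {Λ : Set (List Bool × ι)}
    {g : List Bool → List Bool}
    (h : ∀ x ∈ T₁.map (fun x => (false :: x.1, x.2)) ++ T₂.map (fun x => (true :: x.1, x.2)),
      (g x.1, x.2) ∈ Λ) :
    (∀ x ∈ T₁, (g (false :: x.1), x.2) ∈ Λ) ∧ ∀ x ∈ T₂, (g (true :: x.1), x.2) ∈ Λ :=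
  ⟨fun x hx => h (false :: x.1, x.2) (List.mem_append_left _ (List.mem_map.2 ⟨x, hx, rfl⟩)),
    fun x hx => h (true :: x.1, x.2) (List.mem_append_right _ (List.mem_map.2 ⟨x, hx, rfl⟩))⟩

theorem flatSat_pd {Λ : Set (List Bool × ι)} (φ : TS S (ι ⊕ ι) (Sum.elim ar ar)) :
    ∀ g : List Bool → List Bool, (∀ x ∈ slots φ, (g x.1, x.2) ∈ Λ) →
      PD (S := S) (ak := fun x : List Bool × ι => ar x.2) Λ
        (fun _ I E s => flatSat I φ (Env.pull g E) s) := by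
  induction φ with
  | rel r v => exact fun _ _ => .rel r v
  | nrel r v => exact fun _ _ => .nrel r v
  | eq x y => exact fun _ _ => .eq x y
  | neq x y => exact fun _ _ => .neq x y
  | dep i v =>
    intro g h
    cases i with
    | inl i =>
      exact PD.atom (ak := fun x : List Bool × ι => ar x.2) (g [], i)
        (h ([], i) (List.mem_singleton.2 rfl)) v
    | inr i => exact .true_pd
  | and φ ψ ih1 ih2 =>
    exact fun g h => .and (ih1 (fun l => g (false :: l)) (slots_append_mem h).1)
      (ih2 (fun l => g (true :: l)) (slots_append_mem h).2)
  | or φ ψ ih1 ih2 =>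
    exact fun g h => .or (ih1 (fun l => g (false :: l)) (slots_append_mem h).1)
      (ih2 (fun l => g (true :: l)) (slots_append_mem h).2)
  | gdisj φ ψ => exact fun _ _ => .true_pd
  | cneg φ => exact fun _ _ => .true_pd
  | ex v φ ih => exact fun g h => (ih g h).exNamed v
  | al v φ ih => exact fun g h => (ih g h).alNamed v

theorem upSat_pd {D : ∀ i, DepPred (ar i)} (hdc : ∀ i, DownwardsClosed (D i))
    (hfo : ∀ i, FirstOrderDep (D i)) {Λ : Set (List Bool × ι)}
    (φ : TS S (ι ⊕ ι) (Sum.elim ar ar)) :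
    ∀ g : List Bool → List Bool, (∀ x ∈ slots φ, (g x.1, x.2) ∈ Λ) →
      ∀ T : Pred S (List Bool × ι) (fun x => ar x.2), PD Λ T →
        PD Λ (fun M I E _ => upSat D I φ (Env.pull g E) {z : ℕ → M | T M I E z} :
          Pred S (List Bool × ι) (fun x => ar x.2)) := by
  induction φ with
  | dep i v =>
    intro g h T hT
    cases i with
    | inl i => exact .true_pd
    | inr i =>
      obtain ⟨χ, hχ, hχD⟩ := compl_positive (hdc i) (hfo i)
      exact .congr (hχ.subst (fun M I E => teamProj (k := ar i) v {z | T M I E z})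
        (hT.mem_teamProj (k := ar i) v)) fun M hM I E s => hχD M hM _ s
  | and φ ψ ih1 ih2 =>
    exact fun g h T hT => .and (ih1 (fun l => g (false :: l)) (slots_append_mem h).1 T hT)
      (ih2 (fun l => g (true :: l)) (slots_append_mem h).2 T hT)
  | or φ ψ ih1 ih2 =>
    exact fun g h T hT => .and
      (ih1 (fun l => g (false :: l)) (slots_append_mem h).1 _
        (.and hT (flatSat_pd φ (fun l => g (false :: l)) (slots_append_mem h).1)))
      (ih2 (fun l => g (true :: l)) (slots_append_mem h).2 _
        (.and hT (flatSat_pd ψ (fun l => g (true :: l)) (slots_append_mem h).2)))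
  | ex v φ ih => exact fun g h T hT => ih g h _ (.and (hT.exNamed v) (flatSat_pd φ g h))
  | al v φ ih => exact fun g h T hT => ih g h _ (hT.exNamed v)
  | _ => exact fun _ _ _ _ => .true_pd

end Elimination

/-- A strongly first order family of downwards closed generalized
dependencies is doubly strongly first order: `𝒟 ∪ ∼𝒟` is strongly first
order. -/
theorem downwards_closed_sfo_is_doubly_sfo {ι : Type} {ar : ι → ℕ}
    (D : ∀ i, DepPred (ar i)) (hiso : ∀ i, IsoClosed (D i))
    (hdc : ∀ i, DownwardsClosed (D i)) (hsfo : SFOFam D) :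
    SFOFam (withComplFam D) := by
  intro S φ hφs hφp
  have hP : PD {x | x ∈ slots φ} (fun M I E s =>
      flatSat I φ E s ∧ upSat D I φ E {_z : ℕ → M | True} :
      Pred S (List Bool × ι) fun x => ar x.2) :=
    .and (flatSat_pd φ id fun x hx => hx)
      (upSat_pd hdc (fun i => hsfo.firstOrderDep i) φ id (fun x hx => hx) _ .true_pd)
  obtain ⟨φ', hs', hp', hφ'⟩ := exists_sentence_of_pd Prod.snd D hdc (slots φ) hP
  obtain ⟨ψ, hψ, hiff⟩ := hsfo S φ' hs' hp'
  refine ⟨ψ, hψ, fun M hM I => ?_⟩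
  rw [← hiff M hM I, hφ' M hM I, TTrue, TSat_iff_exists_env hdc I φ hφp]
  refine exists_congr fun E => and_congr_right fun _ => ?_
  obtain ⟨m₀⟩ := hM.to_nonempty
  constructor
  · exact fun h m => ⟨h.1 _ trivial, h.2⟩
  · refine fun h => ⟨fun s _ => (flatSat_congr I φ E _ s fun x hx => ?_).1 (h m₀).1, (h m₀).2⟩
    rw [show fv φ = ∅ from hφs] at hx
    exact hx.elim

end DSFO
end
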